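/- arXiv:2111.08847 — 2 statements merged into one kernel-verified Lean document; each statement's English description precedes it below -/
import Mathlib

section
/- Fix an arbitrary triple of distinct primes p, q, r. For every ε > 0 there exists a_ε such that for all exponents a ≥ a_ε there exist positive integers b and c (with p^a, q^b, r^c > 2) such that the set of coefficients A_{p^a,q^b,r^c} of the unitary cyclotomic polynomial Φ*_{p^a q^b r^c} contains every integer n with |n| ≤ (1/4 − ε)·p^a. -/
open Polynomial

/-- The ternary inclusion-exclusion polynomial `Q_{p,q,r}`. -/
noncomputable def Qpoly (p q r : ℕ) : Polynomial ℤ :=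
  ((X ^ (p * q * r) - 1) * (X ^ p - 1) * (X ^ q - 1) * (X ^ r - 1)) /ₘ
    ((X ^ (p * q) - 1) * (X ^ (q * r) - 1) * (X ^ (r * p) - 1) * (X - 1))

/-- The set `A_{p,q,r}` of coefficients of `Q_{p,q,r}` (whose degree is `(p-1)(q-1)(r-1)`). -/
noncomputable def coeffSet (p q r : ℕ) : Set ℤ :=
  {n : ℤ | ∃ m : ℕ, m ≤ (p - 1) * (q - 1) * (r - 1) ∧ (Qpoly p q r).coeff m = n}

theorem divisors_mul_inter_divisors_mul {a b c : ℕ} (ha : a ≠ 0) (hb : b ≠ 0) (hc : c ≠ 0)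
    (hac : a.Coprime c) : (a * b).divisors ∩ (b * c).divisors = b.divisors := by
  ext d
  simp only [Finset.mem_inter, Nat.mem_divisors]
  constructor
  · rintro ⟨⟨h1, -⟩, h2, -⟩
    have h := Nat.dvd_gcd h1 h2
    rw [mul_comm a b, Nat.gcd_mul_left, hac, mul_one] at h
    exact ⟨h, hb⟩
  · rintro ⟨h, -⟩
    exact ⟨⟨h.mul_left a, by positivity⟩, h.mul_right c, by positivity⟩

theorem exists_inclusionExclusion_factor {P Q R : ℕ} (hP : P ≠ 0) (hQ : Q ≠ 0) (hR : R ≠ 0)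
    (hPQ : P.Coprime Q) (hPR : P.Coprime R) (hQR : Q.Coprime R) :
    ∃ D : ℤ[X], (X ^ (P * Q * R) - 1) * (X ^ P - 1) * (X ^ Q - 1) * (X ^ R - 1) =
      ((X ^ (P * Q) - 1) * (X ^ (Q * R) - 1) * (X ^ (R * P) - 1) * (X - 1)) * D := by
  let f : ℕ → ℤ[X] := fun d => cyclotomic d ℤ
  have hf : ∀ n : ℕ, n ≠ 0 → (X ^ n - 1 : ℤ[X]) = ∏ d ∈ n.divisors, f d := fun n hn =>
    (prod_cyclotomic_eq_X_pow_sub_one (Nat.pos_of_ne_zero hn) ℤ).symm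
  have i1 : (P * Q).divisors ∩ (Q * R).divisors = Q.divisors :=
    divisors_mul_inter_divisors_mul hP hQ hR hPR
  have i2 : (Q * R).divisors ∩ (R * P).divisors = R.divisors :=
    divisors_mul_inter_divisors_mul hQ hR hP hPQ.symm
  have i3 : (P * Q).divisors ∩ (R * P).divisors = P.divisors := by
    rw [Finset.inter_comm]
    exact divisors_mul_inter_divisors_mul hR hP hQ hQR.symm
  have i4 : P.divisors ∩ R.divisors = Nat.divisors 1 := by
    have := divisors_mul_inter_divisors_mul hP one_ne_zero hR hPR
    rwa [mul_one, one_mul] at this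
  have e1 := Finset.prod_union_inter (f := f) (s₁ := (P * Q).divisors) (s₂ := (Q * R).divisors)
  have e2 := Finset.prod_union_inter (f := f) (s₁ := (P * Q).divisors ∪ (Q * R).divisors)
    (s₂ := (R * P).divisors)
  have e3 := Finset.prod_union_inter (f := f) (s₁ := P.divisors) (s₂ := R.divisors)
  rw [Finset.union_inter_distrib_right, i2, i3] at e2
  rw [i1] at e1
  rw [i4] at e3
  have hsub : (P * Q).divisors ∪ (Q * R).divisors ∪ (R * P).divisors ⊆ (P * Q * R).divisors := by
    have h0 : P * Q * R ≠ 0 := by positivity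
    refine Finset.union_subset (Finset.union_subset ?_ ?_) ?_ <;>
      refine Nat.divisors_subset_of_dvd h0 ?_
    · exact ⟨R, rfl⟩
    · exact ⟨P, by ring⟩
    · exact ⟨Q, by ring⟩
  have e4 := Finset.prod_sdiff (f := f) hsub
  refine ⟨∏ d ∈ (P * Q * R).divisors \
    ((P * Q).divisors ∪ (Q * R).divisors ∪ (R * P).divisors), f d, ?_⟩
  have h1 := hf 1 one_ne_zero
  rw [pow_one] at h1
  rw [hf (P * Q * R) (by positivity), hf P hP, hf Q hQ, hf R hR, hf (P * Q) (by positivity),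
    hf (Q * R) (by positivity), hf (R * P) (by positivity), h1, ← e4]
  generalize ∏ d ∈ (P * Q * R).divisors \
    ((P * Q).divisors ∪ (Q * R).divisors ∪ (R * P).divisors), f d = D at *
  generalize ∏ d ∈ (P * Q).divisors ∪ (Q * R).divisors ∪ (R * P).divisors, f d = A at *
  generalize ∏ d ∈ (P * Q).divisors ∪ (Q * R).divisors, f d = B at *
  linear_combination D * (∏ d ∈ Q.divisors, f d) * (∏ d ∈ Nat.divisors 1, f d) * e2 +
    D * (∏ d ∈ (R * P).divisors, f d) * (∏ d ∈ Nat.divisors 1, f d) * e1 -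
    D * A * (∏ d ∈ Q.divisors, f d) * e3

theorem Qpoly_mul {P Q R : ℕ} (hP : P ≠ 0) (hQ : Q ≠ 0) (hR : R ≠ 0)
    (hPQ : P.Coprime Q) (hPR : P.Coprime R) (hQR : Q.Coprime R) :
    ((X ^ (P * Q) - 1) * (X ^ (Q * R) - 1) * (X ^ (R * P) - 1) * (X - 1)) * Qpoly P Q R =
      (X ^ (P * Q * R) - 1) * (X ^ P - 1) * (X ^ Q - 1) * (X ^ R - 1) := by
  obtain ⟨D, hD⟩ := exists_inclusionExclusion_factor hP hQ hR hPQ hPR hQR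
  have hm : ((X ^ (P * Q) - 1) * (X ^ (Q * R) - 1) * (X ^ (R * P) - 1) * (X - 1) : ℤ[X]).Monic :=
    (((monic_X_pow_sub_C 1 (by positivity)).mul (monic_X_pow_sub_C 1 (by positivity))).mul
      (monic_X_pow_sub_C 1 (by positivity))).mul (monic_X_sub_C 1)
  rw [Qpoly, hD, mul_divByMonic_cancel_left _ hm]

theorem natDegree_Qpoly {P Q R : ℕ} (hP : P ≠ 0) (hQ : Q ≠ 0) (hR : R ≠ 0)
    (hPQ : P.Coprime Q) (hPR : P.Coprime R) (hQR : Q.Coprime R) :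
    (Qpoly P Q R).natDegree = (P - 1) * (Q - 1) * (R - 1) := by
  have hm : ∀ n : ℕ, n ≠ 0 → (X ^ n - 1 : ℤ[X]).Monic := fun n hn => monic_X_pow_sub_C 1 hn
  have hd : ∀ n : ℕ, (X ^ n - 1 : ℤ[X]).natDegree = n := fun n => natDegree_X_pow_sub_C
  have h1 : (X - 1 : ℤ[X]).Monic := monic_X_sub_C 1
  have hd1 : (X - 1 : ℤ[X]).natDegree = 1 := natDegree_X_sub_C 1
  have a1 := hm (P * Q) (by positivity)
  have a2 := hm (Q * R) (by positivity)
  have a3 := hm (R * P) (by positivity)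
  have a4 := hm (P * Q * R) (by positivity)
  have hL := ((a1.mul a2).mul a3).mul h1
  have h := congrArg natDegree (Qpoly_mul hP hQ hR hPQ hPR hQR)
  have hne : Qpoly P Q R ≠ 0 := by
    intro h0
    have := Qpoly_mul hP hQ hR hPQ hPR hQR
    rw [h0, mul_zero] at this
    exact (((a4.mul (hm P hP)).mul (hm Q hQ)).mul (hm R hR)).ne_zero this.symm
  rw [hL.natDegree_mul' hne, ((a1.mul a2).mul a3).natDegree_mul h1, (a1.mul a2).natDegree_mul a3,
    a1.natDegree_mul a2, ((a4.mul (hm P hP)).mul (hm Q hQ)).natDegree_mul (hm R hR),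
    (a4.mul (hm P hP)).natDegree_mul (hm Q hQ), a4.natDegree_mul (hm P hP)] at h
  simp only [hd, hd1] at h
  obtain ⟨x, rfl⟩ := Nat.exists_eq_succ_of_ne_zero hP
  obtain ⟨y, rfl⟩ := Nat.exists_eq_succ_of_ne_zero hQ
  obtain ⟨z, rfl⟩ := Nat.exists_eq_succ_of_ne_zero hR
  simp only [Nat.succ_eq_add_one, Nat.add_sub_cancel] at h ⊢
  nlinarith

theorem emultiplicity_pow_sub_one {p : ℕ} (hp : p.Prime) {g : ℤ} (hg : (p : ℤ) ∣ g - 1)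
    (hg2 : p = 2 → 4 ∣ g - 1) (n : ℕ) :
    emultiplicity (p : ℤ) (g ^ n - 1) = emultiplicity (p : ℤ) (g - 1) + emultiplicity p n := by
  have hpg : ¬ (p : ℤ) ∣ g := fun h => by
    have h1 : (p : ℤ) ∣ 1 := by simpa using dvd_sub h hg
    exact hp.one_lt.ne' (by exact_mod_cast Int.eq_one_of_dvd_one (by positivity) h1)
  rcases hp.eq_two_or_odd' with rfl | hodd
  · have := Int.two_pow_sub_pow' (y := 1) n (hg2 rfl) (by exact_mod_cast hpg)
    rw [one_pow] at this
    rw [← Int.natCast_emultiplicity 2 n]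
    exact_mod_cast this
  · simpa using Int.emultiplicity_pow_sub_pow hp hodd (y := 1) hg hpg n

theorem exists_mul_pow_modEq_one {p : ℕ} (hp : p.Prime) {g : ℤ} {K : ℕ} (hK : K ≠ 0)
    (hg2 : p = 2 → 4 ∣ g - 1) (hgK : emultiplicity (p : ℤ) (g - 1) = K) {x : ℤ}
    (hx : (p : ℤ) ^ K ∣ x - 1) (a : ℕ) : ∃ c : ℕ, (p : ℤ) ^ a ∣ x * g ^ c - 1 := by
  have hp' : _root_.Prime (p : ℤ) := Nat.prime_iff_prime_int.mp hp
  have hg : (p : ℤ) ∣ g - 1 := (dvd_pow_self _ hK).trans (emultiplicity_eq_coe.mp hgK).1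
  induction a with
  | zero => exact ⟨0, by simp⟩
  | succ a ih =>
    rcases lt_or_ge a K with haK | haK
    · exact ⟨0, by simpa using (pow_dvd_pow _ haK).trans hx⟩
    obtain ⟨c, z, hz⟩ := ih
    have hm : emultiplicity (p : ℤ) (g ^ p ^ (a - K) - 1) = a := by
      rw [emultiplicity_pow_sub_one hp hg hg2, hgK,
        emultiplicity_pow_self_of_prime (Nat.prime_iff.mp hp)]
      exact_mod_cast Nat.add_sub_cancel' haK
    obtain ⟨⟨t, ht⟩, hnt⟩ := emultiplicity_eq_coe.mp hm
    have hpt : ¬ (p : ℤ) ∣ t := fun ⟨s, hs⟩ => hnt ⟨s, by rw [ht, hs]; ring⟩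
    have key : ∀ e : ℕ, (p : ℤ) ^ (a + 1) ∣
        x * g ^ (c + e * p ^ (a - K)) - 1 - p ^ a * (z + e * t) := by
      intro e
      induction e with
      | zero => simp [hz]
      | succ e ihe =>
        obtain ⟨y, hy⟩ := ihe
        obtain ⟨a', rfl⟩ : ∃ a', a = a' + 1 := ⟨a - 1, by omega⟩
        refine ⟨y + p ^ a' * t * (z + e * t) + p ^ (a' + 1) * t * y, ?_⟩
        have h1 : x * g ^ (c + (e + 1) * p ^ (a' + 1 - K)) =
            (x * g ^ (c + e * p ^ (a' + 1 - K))) * g ^ p ^ (a' + 1 - K) := by ring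
        have h2 : g ^ p ^ (a' + 1 - K) = 1 + p ^ (a' + 1) * t := by linarith
        have h3 : x * g ^ (c + e * p ^ (a' + 1 - K)) =
            1 + p ^ (a' + 1) * (z + e * t) + p ^ (a' + 1 + 1) * y := by linarith
        rw [h1, h2, h3]
        push_cast
        ring
    obtain ⟨e, he⟩ : ∃ e : ℕ, (p : ℤ) ∣ z + e * t := by
      have hcop : IsCoprime (p : ℤ) t := (hp'.irreducible.coprime_iff_not_dvd).mpr hpt
      obtain ⟨α, β, hαβ⟩ := hcop
      have hpos : (0 : ℤ) < p := by exact_mod_cast hp.pos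
      refine ⟨((-z * β) % p).toNat, ?_⟩
      rw [Int.toNat_of_nonneg (Int.emod_nonneg _ hpos.ne'), Int.emod_def]
      exact ⟨z * α - (-z * β / p) * t, by linear_combination (-z) * hαβ⟩
    refine ⟨c + e * p ^ (a - K), ?_⟩
    obtain ⟨y, hy⟩ := key e
    obtain ⟨s, hs⟩ := he
    exact ⟨y + s, by rw [hs] at hy; linear_combination hy⟩

theorem exists_pow_modEq_inv {p q r : ℕ} (hp : p.Prime) (hq : q.Prime) (hr : r.Prime)
    (hpq : p ≠ q) (hpr : p ≠ r) (hqr : q ≠ r) :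
    ∃ K L : ℕ, ∀ (a b : ℕ) (x y : ℤ), (p : ℤ) ^ K ∣ x - 1 → (q : ℤ) ^ L ∣ y - 1 →
      ∀ B : ℕ, ∃ c : ℕ, B < c ∧ (p : ℤ) ^ a ∣ x * r ^ c - 1 ∧ (q : ℤ) ^ b ∣ y * r ^ c - 1 := by
  set N := 2 * ((p - 1) * (q - 1)) with hN
  set g : ℤ := (r : ℤ) ^ N with hgdef
  have hp1 := hp.two_le
  have hq1 := hq.two_le
  have hN0 : N ≠ 0 := by
    have : 0 < (p - 1) * (q - 1) := Nat.mul_pos (by omega) (by omega)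
    omega
  have fermat : ∀ l : ℕ, l.Prime → l ≠ r → (l - 1) ∣ N → (l : ℤ) ∣ g - 1 := by
    rintro l hl hlr ⟨k, hk⟩
    have hc : IsCoprime (r : ℤ) l :=
      Nat.isCoprime_iff_coprime.mpr ((Nat.coprime_primes hr hl).mpr hlr.symm)
    have := (Int.ModEq.pow_card_sub_one_eq_one hl hc).pow k
    rw [one_pow, ← pow_mul, ← hk] at this
    exact this.symm.dvd
  have four : ∀ l : ℕ, l ≠ r → l = 2 → (4 : ℤ) ∣ g - 1 := by
    rintro l hlr rfl
    have hodd : Odd r := hr.odd_of_ne_two hlr.symm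
    have h4 : (r : ℤ) ^ 2 ≡ 1 [ZMOD 4] := by
      obtain ⟨k, rfl⟩ := hodd
      exact (Int.modEq_iff_dvd.mpr ⟨k ^ 2 + k, by push_cast; ring⟩ : (1 : ℤ) ≡ _ [ZMOD 4]).symm
    have := h4.pow ((p - 1) * (q - 1))
    rw [one_pow, ← pow_mul, ← hN] at this
    exact this.symm.dvd
  have hgp := fermat p hp hpr ⟨2 * (q - 1), by rw [hN]; ring⟩
  have hgq := fermat q hq hqr ⟨2 * (p - 1), by rw [hN]; ring⟩
  have hgne : g - 1 ≠ 0 := by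
    have : (1 : ℤ) < g := one_lt_pow₀ (by exact_mod_cast hr.one_lt) hN0
    omega
  have mult : ∀ l : ℕ, l.Prime → (l : ℤ) ∣ g - 1 →
      ∃ K : ℕ, K ≠ 0 ∧ emultiplicity (l : ℤ) (g - 1) = K := by
    intro l hl hlg
    have hfin : FiniteMultiplicity (l : ℤ) (g - 1) :=
      Int.finiteMultiplicity_iff.mpr ⟨by simpa using hl.one_lt.ne', hgne⟩
    refine ⟨multiplicity (l : ℤ) (g - 1), fun h => ?_, hfin.emultiplicity_eq_multiplicity⟩
    have h0 := hfin.emultiplicity_eq_multiplicity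
    rw [h, Nat.cast_zero] at h0
    exact emultiplicity_eq_zero.mp h0 hlg
  obtain ⟨K, hK0, hK⟩ := mult p hp hgp
  obtain ⟨L, hL0, hL⟩ := mult q hq hgq
  have single : ∀ l m : ℕ, l.Prime → m.Prime → l ≠ m → l ≠ r → m ≠ r → (l : ℤ) ∣ g - 1 →
      (m : ℤ) ∣ g - 1 → ∀ k : ℕ, k ≠ 0 → emultiplicity (l : ℤ) (g - 1) = k → ∀ (a b : ℕ) (x : ℤ),
      (l : ℤ) ^ k ∣ x - 1 → ∃ c : ℕ, (l : ℤ) ^ a ∣ x * r ^ c - 1 ∧ (m : ℤ) ^ b ∣ r ^ c - 1 := by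
    intro l m hl hm hlm hlr hmr hgl hgm k hk0 hk a b x hx
    have e1 : emultiplicity (l : ℤ) (g ^ m ^ b - 1) = k := by
      rw [emultiplicity_pow_sub_one hl hgl (four l hlr), hk,
        emultiplicity_eq_zero.mpr fun h =>
          hlm ((Nat.prime_dvd_prime_iff_eq hl hm).mp (hl.dvd_of_dvd_pow h)), add_zero]
    have e2 : (m : ℤ) ^ b ∣ g ^ m ^ b - 1 := by
      rw [pow_dvd_iff_le_emultiplicity, emultiplicity_pow_sub_one hm hgm (four m hmr),
        emultiplicity_pow_self_of_prime (Nat.prime_iff.mp hm)]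
      exact le_add_self
    have e3 : l = 2 → (4 : ℤ) ∣ g ^ m ^ b - 1 := fun h =>
      (four l hlr h).trans (by simpa using sub_dvd_pow_sub_pow g 1 (m ^ b))
    obtain ⟨c, hc⟩ := exists_mul_pow_modEq_one hl hk0 e3 e1 hx a
    refine ⟨N * m ^ b * c, ?_, ?_⟩
    · rwa [pow_mul, pow_mul]
    · rw [pow_mul, pow_mul]
      exact e2.trans (by simpa using sub_dvd_pow_sub_pow (g ^ m ^ b) 1 c)
  refine ⟨K, L, fun a b x y hx hy B => ?_⟩
  obtain ⟨c₁, h1, h1'⟩ := single p q hp hq hpq hpr hqr hgp hgq K hK0 hK a b x hx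
  obtain ⟨c₂, h2, h2'⟩ := single q p hq hp hpq.symm hqr hpr hgq hgp L hL0 hL b a y hy
  set T := (p ^ a * q ^ b).totient * (B + 1)
  have hcop : r.Coprime (p ^ a * q ^ b) :=
    Nat.Coprime.mul_right (((Nat.coprime_primes hr hp).mpr hpr.symm).pow_right a)
      (((Nat.coprime_primes hr hq).mpr hqr.symm).pow_right b)
  have hT : (p : ℤ) ^ a * q ^ b ∣ r ^ T - 1 := by
    have := (Nat.ModEq.pow_totient hcop).pow (B + 1)
    rw [one_pow, ← pow_mul] at this
    have := (Int.natCast_modEq_iff.mpr this).symm.dvd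
    exact_mod_cast this
  have hTB : B < T := by
    have : 0 < (p ^ a * q ^ b).totient := Nat.totient_pos.mpr
      (Nat.mul_pos (pow_pos hp.pos a) (pow_pos hq.pos b))
    exact Nat.lt_of_lt_of_le (Nat.lt_succ_self B) (Nat.le_mul_of_pos_left _ this)
  have combine : ∀ m X Y Z W : ℤ, m ∣ X * Y - 1 → m ∣ Z - 1 → m ∣ W - 1 →
      m ∣ X * (Y * Z * W) - 1 := by
    rintro m X Y Z W ⟨i, hi⟩ ⟨j, hj⟩ ⟨k, hk⟩
    exact ⟨i * Z * W + j * W + k, by linear_combination Z * W * hi + W * hj + hk⟩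
  refine ⟨c₁ + c₂ + T, by omega, ?_, ?_⟩
  · rw [pow_add, pow_add]
    exact combine _ _ _ _ _ h1 h2' ((Dvd.intro _ rfl).trans hT)
  · rw [pow_add, pow_add, mul_comm ((r : ℤ) ^ c₁)]
    exact combine _ _ _ _ _ h2 h1' ((Dvd.intro_left _ rfl).trans hT)

/-- The exponent attached to the lattice point `(j, k, s, t)`. -/
def boxExponent (P Q R c : ℕ) (x : ℕ × ℕ × ℕ × ℕ) : ℕ :=
  R * (Q * x.1 + P * x.2.1 + c) + x.2.2.1 + P * Q * x.2.2.2

/-- The lattice points `(j, k, s, t)` with `j < u`, `k < l`, `s < P` and `t < T`. -/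
def box (u l P T : ℕ) : Finset (ℕ × ℕ × ℕ × ℕ) :=
  Finset.range u ×ˢ Finset.range l ×ˢ Finset.range P ×ˢ Finset.range T

/-- The number of points of the box whose exponent is `n`. -/
def boxCount (P Q R u l c T n : ℕ) : ℕ :=
  ((box u l P T).filter (fun x => boxExponent P Q R c x = n)).card

theorem mem_box {u l P T j k s t : ℕ} :
    (j, k, s, t) ∈ box u l P T ↔ j < u ∧ k < l ∧ s < P ∧ t < T := by
  simp [box]

theorem boxExponent_mk (P Q R c j k s t : ℕ) :
    boxExponent P Q R c (j, k, s, t) = R * (Q * j + P * k + c) + s + P * Q * t :=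
  rfl

/-- The generating polynomial of `boxCount`. -/
noncomputable def boxGenPoly (P Q R u l c T : ℕ) : ℤ[X] :=
  ∑ x ∈ box u l P T, X ^ boxExponent P Q R c x

theorem coeff_boxGenPoly (P Q R u l c T n : ℕ) :
    (boxGenPoly P Q R u l c T).coeff n = boxCount P Q R u l c T n := by
  simp [boxGenPoly, boxCount, finsetSum_coeff, coeff_X_pow, Finset.sum_boole, eq_comm]

theorem boxGenPoly_mul (P Q R u l c T : ℕ) :
    boxGenPoly P Q R u l c T *
        ((X ^ (R * Q) - 1) * (X ^ (R * P) - 1) * (X - 1) * (X ^ (P * Q) - 1)) =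
      X ^ (R * c) * ((X ^ (R * Q * u) - 1) * (X ^ (R * P * l) - 1) * (X ^ P - 1) *
        (X ^ (P * Q * T) - 1)) := by
  have h : boxGenPoly P Q R u l c T = X ^ (R * c) * ((∑ j ∈ Finset.range u, (X ^ (R * Q)) ^ j) *
      ((∑ k ∈ Finset.range l, (X ^ (R * P)) ^ k) * ((∑ s ∈ Finset.range P, X ^ s) *
        (∑ t ∈ Finset.range T, (X ^ (P * Q)) ^ t)))) := by
    rw [Finset.sum_mul_sum, ← Finset.sum_product', Finset.sum_mul_sum, ← Finset.sum_product',
      Finset.sum_mul_sum, ← Finset.sum_product', Finset.mul_sum, boxGenPoly]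
    refine Finset.sum_congr rfl fun x _ => ?_
    simp only [boxExponent, ← pow_mul, ← pow_add]
    congr 1
    ring
  rw [h, pow_mul X (R * Q) u, pow_mul X (R * P) l, pow_mul X (P * Q) T, ← geom_sum_mul _ u,
    ← geom_sum_mul _ l, ← geom_sum_mul _ T, ← geom_sum_mul (X : ℤ[X]) P]
  ring

theorem Qpoly_mul_X_pow_sub_one {P Q R : ℕ} (hP : P ≠ 0) (hQ : Q ≠ 0) (hR : R ≠ 0)
    (hPQ : P.Coprime Q) (hPR : P.Coprime R) (hQR : Q.Coprime R) {u l u' l' : ℕ}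
    (hu : u + u' = P) (hl : l + l' = Q) (hul : u * Q + l * P = 1 + P * Q) (T : ℕ) :
    Qpoly P Q R * (X ^ (P * Q * T) - 1) =
      (boxGenPoly P Q R u l 0 T - boxGenPoly P Q R u' l' 1 T) * (X ^ Q - 1) := by
  have hne : ∀ n : ℕ, n ≠ 0 → (X ^ n - 1 : ℤ[X]) ≠ 0 := fun n hn =>
    (monic_X_pow_sub_C (1 : ℤ) hn).ne_zero
  have h1 : (X - 1 : ℤ[X]) ≠ 0 := X_sub_C_ne_zero 1
  have hM : ((X ^ (R * Q) - 1) * (X ^ (R * P) - 1) * (X - 1) * (X ^ (P * Q) - 1) : ℤ[X]) ≠ 0 :=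
    mul_ne_zero (mul_ne_zero (mul_ne_zero (hne _ (by positivity)) (hne _ (by positivity))) h1)
      (hne _ (by positivity))
  apply mul_right_cancel₀ hM
  have e := Qpoly_mul hP hQ hR hPQ hPR hQR
  have e0 := boxGenPoly_mul P Q R u l 0 T
  have e1 := boxGenPoly_mul P Q R u' l' 1 T
  have x1 : (X : ℤ[X]) ^ (R * Q * u) * X ^ (R * P * l) = X ^ R * X ^ (P * Q * R) := by
    rw [← pow_add, ← pow_add]
    congr 1
    linear_combination R * hul
  have hul' : u' * Q + l' * P + 1 = P * Q := by
    subst hu hl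
    linarith
  have x2 : (X : ℤ[X]) ^ R * (X ^ (R * Q * u') * X ^ (R * P * l')) = X ^ (P * Q * R) := by
    rw [← pow_add, ← pow_add]
    congr 1
    linear_combination R * hul'
  have x3 : (X : ℤ[X]) ^ R * X ^ (R * Q * u') = X ^ (R * P * l) := by
    rw [← pow_add]
    congr 1
    have : l * P = 1 + u' * Q := by
      subst hu
      linarith
    linear_combination R * this.symm
  have x4 : (X : ℤ[X]) ^ R * X ^ (R * P * l') = X ^ (R * Q * u) := by
    rw [← pow_add]
    congr 1
    have : u * Q = 1 + l' * P := by
      subst hl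
      linarith
    linear_combination R * this.symm
  rw [mul_comm Q R] at e
  rw [mul_zero, pow_zero, one_mul] at e0
  rw [mul_one] at e1
  linear_combination (X ^ (P * Q * T) - 1) * e - (X ^ Q - 1) * e0 + (X ^ Q - 1) * e1 -
    (X ^ Q - 1) * (X ^ P - 1) * (X ^ (P * Q * T) - 1) * (x1 - x2 + x3 + x4)

theorem boxCount_one_le_one {P Q R u l c : ℕ} (hPQ : P.Coprime Q) (hPR : P ≤ R) (hu : u ≤ P)
    (n : ℕ) : boxCount P Q R u l c 1 n ≤ 1 := by
  rw [boxCount, Finset.card_le_one]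
  intro x hx y hy
  obtain ⟨j, k, s, t⟩ := x
  obtain ⟨j', k', s', t'⟩ := y
  rw [Finset.mem_filter, mem_box, boxExponent_mk] at hx hy
  obtain ⟨⟨hj, -, hs, ht⟩, h⟩ := hx
  obtain ⟨⟨hj', -, hs', ht'⟩, h'⟩ := hy
  obtain rfl : t = 0 := by omega
  obtain rfl : t' = 0 := by omega
  rw [mul_zero, add_zero] at h h'
  have hR : 0 < R := by omega
  have d : n / R = Q * j + P * k + c := by
    rw [← h, Nat.mul_add_div hR, Nat.div_eq_of_lt (by omega), add_zero]
  have d' : n / R = Q * j' + P * k' + c := by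
    rw [← h', Nat.mul_add_div hR, Nat.div_eq_of_lt (by omega), add_zero]
  have m : n % R = s := by rw [← h, Nat.mul_add_mod, Nat.mod_eq_of_lt (by omega)]
  have m' : n % R = s' := by rw [← h', Nat.mul_add_mod, Nat.mod_eq_of_lt (by omega)]
  have hjk : Q * j + P * k = Q * j' + P * k' := by omega
  have hmod : Q * j ≡ Q * j' [MOD P] := by
    have : Q * j + P * k ≡ Q * j' + P * k' [MOD P] := by rw [hjk]
    simpa [Nat.ModEq] using this
  have hjj : j = j' := (Nat.ModEq.cancel_left_of_coprime hPQ hmod).eq_of_lt_of_lt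
    (by omega) (by omega)
  subst hjj
  have hkk : k = k' := Nat.eq_of_mul_eq_mul_left (by omega : 0 < P) (by omega)
  rw [hkk, ← m, ← m']

theorem mod_lt_of_boxCount_one_ne_zero {P Q R u l c n : ℕ} (hPR : P ≤ R)
    (h : boxCount P Q R u l c 1 n ≠ 0) : n % R < P := by
  obtain ⟨⟨j, k, s, t⟩, hx⟩ := Finset.card_ne_zero.mp h
  rw [Finset.mem_filter, mem_box, boxExponent_mk] at hx
  obtain ⟨⟨-, -, hs, ht⟩, rfl⟩ := hx
  obtain rfl : t = 0 := by omega
  rw [mul_zero, add_zero, Nat.mul_add_mod, Nat.mod_eq_of_lt (by omega)]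
  exact hs

theorem boxCount_sub_shift_mem {P Q R u l u' l' : ℕ} (hPQ : P.Coprime Q) (hPQ' : P ≤ Q)
    (hR : P + Q ≤ R) (hu : u ≤ P) (hu' : u' ≤ P) (m : ℕ) :
    |((boxCount P Q R u l 0 1 (m + Q) : ℤ) - boxCount P Q R u' l' 1 1 (m + Q)) -
      (boxCount P Q R u l 0 1 m - boxCount P Q R u' l' 1 1 m)| ≤ 1 := by
  have hPR : P ≤ R := by omega
  have b1 := boxCount_one_le_one (l := l) (c := 0) hPQ hPR hu (m + Q)
  have b2 := boxCount_one_le_one (l := l') (c := 1) hPQ hPR hu' (m + Q)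
  have b3 := boxCount_one_le_one (l := l) (c := 0) hPQ hPR hu m
  have b4 := boxCount_one_le_one (l := l') (c := 1) hPQ hPR hu' m
  rw [abs_le]
  by_cases hm : m % R < P
  · have hm' : P ≤ (m + Q) % R := by
      rw [Nat.add_mod]
      rcases (show Q < R ∨ P = 0 by omega) with hQ | hP
      · rcases lt_or_ge (m % R + Q % R) R with h | h
        · rw [Nat.mod_eq_of_lt h, Nat.mod_eq_of_lt hQ]
          omega
        · rw [Nat.mod_eq_of_lt hQ] at h
          omega
      · omega
    have z1 : boxCount P Q R u l 0 1 (m + Q) = 0 := by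
      by_contra h
      exact absurd (mod_lt_of_boxCount_one_ne_zero hPR h) (by omega)
    have z2 : boxCount P Q R u' l' 1 1 (m + Q) = 0 := by
      by_contra h
      exact absurd (mod_lt_of_boxCount_one_ne_zero hPR h) (by omega)
    rw [z1, z2]
    omega
  · have z1 : boxCount P Q R u l 0 1 m = 0 := by
      by_contra h
      exact absurd (mod_lt_of_boxCount_one_ne_zero hPR h) hm
    have z2 : boxCount P Q R u' l' 1 1 m = 0 := by
      by_contra h
      exact absurd (mod_lt_of_boxCount_one_ne_zero hPR h) hm
    rw [z1, z2]
    omega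

theorem Qpoly_coeff_step {P Q R : ℕ} (hP : P ≠ 0) (hQ : Q ≠ 0) (hPQ : P.Coprime Q)
    (hPR : P.Coprime R) (hQR : Q.Coprime R) {u l u' l' : ℕ} (hu : u + u' = P) (hl : l + l' = Q)
    (hul : u * Q + l * P = 1 + P * Q) (hPQ' : P ≤ Q) (hR : P + Q ≤ R) (n : ℕ) :
    |(Qpoly P Q R).coeff (n + P * Q) - (Qpoly P Q R).coeff n| ≤ 1 := by
  have h := congrArg (fun f => f.coeff (n + P * Q))
    (Qpoly_mul_X_pow_sub_one hP hQ (by omega : R ≠ 0) hPQ hPR hQR hu hl hul 1)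
  have hQle : Q ≤ P * Q := Nat.le_mul_of_pos_left _ (Nat.pos_of_ne_zero hP)
  obtain ⟨m, hm⟩ : ∃ m, n + P * Q = m + Q := ⟨n + P * Q - Q, by omega⟩
  simp only [mul_one, mul_sub, coeff_sub, coeff_mul_X_pow] at h
  rw [hm] at h ⊢
  simp only [coeff_mul_X_pow, coeff_sub, coeff_boxGenPoly] at h
  have hb := boxCount_sub_shift_mem (l := l) (l' := l') hPQ hPQ' hR (by omega : u ≤ P)
    (by omega : u' ≤ P) m
  rw [abs_le] at hb ⊢
  constructor <;> linarith [hb.1, hb.2]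

theorem Qpoly_coeff_of_lt {P Q R : ℕ} (hP : P ≠ 0) (hQ : Q ≠ 0) (hR : R ≠ 0) (hPQ : P.Coprime Q)
    (hPR : P.Coprime R) (hQR : Q.Coprime R) {u l u' l' : ℕ} (hu : u + u' = P) (hl : l + l' = Q)
    (hul : u * Q + l * P = 1 + P * Q) {T n : ℕ} (hn : n < P * Q * T) :
    (Qpoly P Q R).coeff n =
      ((boxCount P Q R u l 0 T n : ℤ) - boxCount P Q R u' l' 1 T n) -
      if Q ≤ n then (boxCount P Q R u l 0 T (n - Q) : ℤ) - boxCount P Q R u' l' 1 T (n - Q)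
      else 0 := by
  have h := congrArg (fun f => f.coeff n)
    (Qpoly_mul_X_pow_sub_one hP hQ hR hPQ hPR hQR hu hl hul T)
  simp only [mul_one, mul_sub, coeff_sub, coeff_mul_X_pow', coeff_boxGenPoly,
    if_neg (not_le.mpr hn)] at h
  linarith

/-- A lattice point whose exponent is `≡ R * P * w + Q * e` modulo `P * Q` lies on a line. -/
theorem exists_lattice_parameter {P Q R w v : ℤ} (hPw : P * w < Q) (hw : 0 < w)
    (hPQ : IsCoprime P Q) (hwv : P ∣ w + v) (hwP : P ∣ w * R + 1) (hwQ : Q ∣ w * R - 1)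
    {j k s e : ℤ} (hk : 0 ≤ k) (hkQ : k < Q) (hs : 0 ≤ s) (hsP : s < P)
    (h : P * Q ∣ R * (Q * j + P * k) + s - (R * P * w + Q * e)) :
    ∃ g : ℤ, 0 ≤ g ∧ g < P ∧ P * k = (P - s) * w + Q * g ∧ P ∣ g - j + v * e := by
  have hP : 0 < P := by omega
  have hQ : 0 < Q := by nlinarith
  obtain ⟨c, hc⟩ := h
  obtain ⟨a, ha⟩ := hwP
  obtain ⟨b, hb⟩ := hwQ
  obtain ⟨d, hd⟩ := hwv
  obtain ⟨g, hg⟩ : Q ∣ P * k - (P - s) * w :=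
    ⟨w * P * c + w * e - b * (P * k - P * w) - w * R * j, by
      linear_combination w * hc - (P * k - P * w) * hb⟩
  have hkP : P * k = (P - s) * w + Q * g := by linarith
  have hsw : (P - s) * w ≤ P * w := by nlinarith
  have hsw' : 0 < (P - s) * w := mul_pos (by omega) hw
  refine ⟨g, ?_, ?_, hkP, ?_⟩
  · by_contra hneg
    have : Q * g ≤ Q * (-1) := by gcongr; omega
    nlinarith [mul_nonneg hP.le hk]
  · by_contra hge
    have h1 : Q * P ≤ Q * g := by gcongr; omega
    have h2 : P * k < P * Q := by gcongr
    nlinarith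
  · refine hPQ.dvd_of_dvd_mul_left (z := g - j + v * e) (y := Q) ?_
    refine ⟨k - w + w * Q * c - a * Q * j - w * R * k + w * R * w + Q * e * d, ?_⟩
    linear_combination w * hc - Q * j * ha - hkP + Q * e * hd

theorem exists_eq_of_step_le_one {f : ℕ → ℤ} (h0 : f 0 ≤ 1) (hf : ∀ t, f (t + 1) ≤ f t + 1)
    {N : ℕ} {u n : ℤ} (hN : u ≤ f N) (hn : 1 ≤ n) (hnu : n ≤ u) : ∃ t, f t = n := by
  classical
  have hex : ∃ t, n ≤ f t := ⟨N, hnu.trans hN⟩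
  refine ⟨Nat.find hex, le_antisymm ?_ (Nat.find_spec hex)⟩
  rcases h : Nat.find hex with _ | t
  · omega
  · have := Nat.find_min hex (m := t) (by omega)
    have := hf t
    omega

theorem boxCount_pos_eq_zero {P Q R u l w v T m : ℕ} {e x : ℤ} (hPw : P * w < Q) (hw : 0 < w)
    (hPQ : P.Coprime Q) (hwv : (P : ℤ) ∣ w + v) (hwP : (P : ℤ) ∣ w * R + 1)
    (hwQ : (Q : ℤ) ∣ w * R - 1) (huv : 2 * u ≤ v)
    (hvP : v + 2 * u ≤ P) (hlQ : l ≤ Q) (he : e = 1 ∨ e = -1)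
    (hm : (m : ℤ) = R * P * w + Q * e + P * Q * x) (hmlt : m < 2 * u * Q * R) :
    boxCount P Q R u l 0 T m = 0 := by
  by_contra h
  obtain ⟨⟨j, k, s, t⟩, hx⟩ := Finset.card_ne_zero.mp h
  rw [Finset.mem_filter, mem_box, boxExponent_mk] at hx
  obtain ⟨⟨hj, hk, hs, -⟩, hval⟩ := hx
  have hval' : (R : ℤ) * (Q * j + P * k) + s + P * Q * t = m := by exact_mod_cast hval
  obtain ⟨g, hg0, hgP, hgk, d, hd⟩ := exists_lattice_parameter (P := P) (Q := Q) (R := R) (w := w)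
    (v := v) (j := j) (k := k) (s := s) (e := e) (by exact_mod_cast hPw) (by exact_mod_cast hw)
    (Nat.isCoprime_iff_coprime.mpr hPQ) hwv hwP hwQ (by positivity) (by omega) (by positivity)
    (by omega) ⟨x - t, by linear_combination hval' + hm⟩
  have hbig : (2 * u : ℤ) ≤ g + j := by
    rcases he with rfl | rfl
    · have h1 : 0 < d := by
        by_contra hneg
        have : (P : ℤ) * d ≤ 0 := mul_nonpos_of_nonneg_of_nonpos (by positivity) (by omega)
        omega
      have h2 : (P : ℤ) * 1 ≤ P * d := by gcongr; omega
      omega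
    · have h1 : 0 ≤ d := by
        by_contra hneg
        have : (P : ℤ) * d ≤ P * (-1) := by gcongr; omega
        omega
      have h2 : 0 ≤ (P : ℤ) * d := by positivity
      omega
  have hRm : R * (Q * j + P * k) ≤ m := by
    rw [← hval, add_zero]
    omega
  have h3 : 2 * u * Q ≤ Q * j + P * k := by
    zify
    rw [hgk]
    have : (0 : ℤ) ≤ (P - s) * w := mul_nonneg (by omega) (by positivity)
    nlinarith [mul_le_mul_of_nonneg_left hbig (by positivity : (0 : ℤ) ≤ Q)]
  have h4 := Nat.mul_le_mul_left R h3
  have h5 : R * (2 * u * Q) = 2 * u * Q * R := by ring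
  omega

theorem boxCount_neg_eq_zero {P Q R u l u' l' w v T m : ℕ} {x : ℤ} (hPw : P * w < Q) (hw : 0 < w)
    (hPQ : P.Coprime Q) (hwv : (P : ℤ) ∣ w + v) (hwP : (P : ℤ) ∣ w * R + 1)
    (hwQ : (Q : ℤ) ∣ w * R - 1) (huP : 4 * u ≤ P) (hu : u + u' = P) (hl : l + l' = Q)
    (hul : u * Q + l * P = 1 + P * Q)
    (hm : (m : ℤ) = R * P * w + P * Q * x) (hmlt : m < 2 * u * Q * R) :
    boxCount P Q R u' l' 1 T m = 0 := by
  by_contra h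
  obtain ⟨⟨j, k, s, t⟩, hx⟩ := Finset.card_ne_zero.mp h
  rw [Finset.mem_filter, mem_box, boxExponent_mk] at hx
  obtain ⟨⟨hj, hk, hs, -⟩, hval⟩ := hx
  have hval' : (R : ℤ) * (Q * j + P * k + 1) + s + P * Q * t = m := by exact_mod_cast hval
  have hul' : (u : ℤ) * Q + l * P = 1 + P * Q := by exact_mod_cast hul
  obtain ⟨g, hg0, hgP, hgk, d, hd⟩ := exists_lattice_parameter (P := P) (Q := Q) (R := R) (w := w)
    (v := v) (j := u + j) (k := l + k) (s := s) (e := 0) (by exact_mod_cast hPw)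
    (by exact_mod_cast hw) (Nat.isCoprime_iff_coprime.mpr hPQ) hwv hwP hwQ (by positivity)
    (by omega) (by positivity) (by omega)
    ⟨x - t + R, by linear_combination hval' + hm + R * hul'⟩
  have hd0 : d = 0 := by
    have h1 : d < 1 := by
      by_contra hneg
      have : (P : ℤ) * 1 ≤ P * d := by gcongr; omega
      omega
    have h2 : -1 < d := by
      by_contra hneg
      have : (P : ℤ) * d ≤ P * (-1) := by gcongr; omega
      omega
    omega
  obtain rfl : g = u + j := by rw [hd0] at hd; linarith
  have hQ : 0 < Q := by omega
  have hsw : (0 : ℤ) ≤ (P - s) * w := mul_nonneg (by omega) (by positivity)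
  have hsw' : ((P : ℤ) - s) * w ≤ P * w := by
    gcongr
    omega
  have hPw' : (P : ℤ) * w < Q := by exact_mod_cast hPw
  have hbig : (P : ℤ) - u ≤ u + j := by
    by_contra hneg
    have h1 : (Q : ℤ) * (u + j) ≤ Q * (P - u - 1) := by gcongr; omega
    have h2 : (0 : ℤ) ≤ P * k := by positivity
    nlinarith
  have hRm : R * (Q * j + P * k + 1) ≤ m := by
    rw [← hval]
    omega
  have h3 : 2 * u * Q ≤ Q * j + P * k + 1 := by
    zify
    have h1 : (Q : ℤ) * (P - u) ≤ Q * (u + j) := by gcongr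
    have h2 : (Q : ℤ) * (4 * u) ≤ Q * P := by
      gcongr
      exact_mod_cast huP
    nlinarith
  have h4 := Nat.mul_le_mul_left R h3
  have h5 : R * (2 * u * Q) = 2 * u * Q * R := by ring
  omega

theorem le_boxCount {P Q R u l w T m x : ℕ} (hPw : P * w < Q) (hw : 0 < w)
    (hPQ : P.Coprime Q) (hwP : (P : ℤ) ∣ w * R + 1)
    (hwQ : (Q : ℤ) ∣ w * R - 1) (huP : 2 * u ≤ P)
    (hul : u * Q + l * P = 1 + P * Q)
    (hm : m = R * (P * w) + P * Q * x) (hmlo : R * (2 * Q * u + P * w) + P ≤ m + 2 * Q * R)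
    (hT : m < T) : u ≤ boxCount P Q R u l 0 T m := by
  rcases Nat.eq_zero_or_pos u with rfl | hu0
  · exact Nat.zero_le _
  have hP : 0 < P := by omega
  have hQ : 0 < Q := by omega
  have hcop : IsCoprime (P : ℤ) w := by
    obtain ⟨a, ha⟩ := hwP
    exact ⟨a, -R, by linear_combination -ha⟩
  have key : ∀ j, j < u → ∃ y : ℕ × ℕ × ℕ, (j, y) ∈ (box u l P T).filter
      (fun x => boxExponent P Q R 0 x = m) := by
    intro j hj
    obtain ⟨s, hs, b, hb⟩ : ∃ s : ℕ, s < P ∧ (P : ℤ) ∣ Q * j - w * s := by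
      obtain ⟨α, β, h⟩ := hcop
      have h0 := Int.emod_nonneg (β * (Q * j)) (by omega : (P : ℤ) ≠ 0)
      refine ⟨((β * (Q * j)) % P).toNat, ?_, ?_⟩
      · have := Int.emod_lt_of_pos (β * (Q * j)) (by omega : (0 : ℤ) < P)
        omega
      · rw [Int.toNat_of_nonneg h0, Int.emod_def]
        exact ⟨α * Q * j + w * (β * (Q * j) / P), by linear_combination (-(Q * j : ℤ)) * h⟩
    have hsw : (s : ℤ) * w ≤ P * w := by gcongr
    have hPw' : (P : ℤ) * w < Q := by exact_mod_cast hPw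
    have hQj : (Q : ℤ) * (j + 1) ≤ Q * u := by gcongr; omega
    have hQj0 : (0 : ℤ) ≤ Q * j := by positivity
    have hQP : (Q : ℤ) * (2 * u) ≤ Q * P := by gcongr; exact_mod_cast huP
    have hul' : (u : ℤ) * Q + l * P = 1 + P * Q := by exact_mod_cast hul
    have hPk : (P : ℤ) * (w + b) = P * w - w * s + Q * j := by linear_combination -hb
    have hk0 : 0 ≤ (w : ℤ) + b := by
      by_contra hneg
      have : (P : ℤ) * (w + b) ≤ P * (-1) := by gcongr; omega
      nlinarith
    obtain ⟨k, hk⟩ := Int.eq_ofNat_of_zero_le hk0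
    rw [hk] at hPk
    have hkl : k < l := by
      have : (P : ℤ) * k < P * l := by
        have : (0 : ℤ) ≤ w * s := by positivity
        nlinarith
      exact_mod_cast lt_of_mul_lt_mul_left this (by positivity)
    have hH : Q * j + P * k + 2 * Q ≤ 2 * Q * u + P * w := by
      zify
      have : (0 : ℤ) ≤ w * s := by positivity
      nlinarith
    have hle : R * (Q * j + P * k) + s ≤ m := by
      have h1 := Nat.mul_le_mul_left R hH
      have h2 : R * (Q * j + P * k + 2 * Q) = R * (Q * j + P * k) + 2 * Q * R := by ring
      omega
    have hdvd : ((P * Q : ℕ) : ℤ) ∣ (m - (R * (Q * j + P * k) + s) : ℤ) := by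
      push_cast
      refine (Nat.isCoprime_iff_coprime.mpr hPQ).mul_dvd ?_ ?_
      · obtain ⟨a, ha⟩ := hwP
        refine ⟨R * w + Q * x - R * b - R * k - a * s, ?_⟩
        rw [hm]
        push_cast
        linear_combination (-R : ℤ) * hb - s * ha
      · obtain ⟨a, ha⟩ := hwQ
        refine ⟨P * x - 2 * R * j + a * s, ?_⟩
        rw [hm]
        push_cast
        linear_combination (-R : ℤ) * hPk + s * ha
    rw [← Nat.cast_mul, ← Nat.cast_mul, ← Nat.cast_add, ← Nat.cast_mul, ← Nat.cast_add,
      ← Nat.cast_sub hle] at hdvd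
    obtain ⟨t, ht⟩ := Int.natCast_dvd_natCast.mp hdvd
    refine ⟨(k, s, t), ?_⟩
    rw [Finset.mem_filter, mem_box, boxExponent_mk]
    refine ⟨⟨hj, hkl, hs, ?_⟩, by rw [add_zero]; omega⟩
    have : t ≤ P * Q * t := Nat.le_mul_of_pos_left _ (by positivity)
    omega
  choose! y hy using key
  have himg : (Finset.range u).image (fun j => (j, y j)) ⊆
      (box u l P T).filter (fun x => boxExponent P Q R 0 x = m) := by
    intro z hz
    obtain ⟨j, hj, rfl⟩ := Finset.mem_image.mp hz
    exact hy j (Finset.mem_range.mp hj)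
  have hcard := Finset.card_le_card himg
  rwa [Finset.card_image_of_injective _ (fun a b h => congrArg Prod.fst h),
    Finset.card_range] at hcard

theorem abs_Qpoly_coeff_le_one_of_lt {P Q R : ℕ} (hP : P ≠ 0) (hQ : Q ≠ 0) (hPQ : P.Coprime Q)
    (hPR : P.Coprime R) (hQR : Q.Coprime R) {u l u' l' : ℕ} (hu : u + u' = P) (hl : l + l' = Q)
    (hul : u * Q + l * P = 1 + P * Q) (hPQ' : P ≤ Q) (hR : P + Q ≤ R) {n : ℕ} (hn : n < P * Q) :
    |(Qpoly P Q R).coeff n| ≤ 1 := by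
  have hPu : u ≤ P := by omega
  have hPu' : u' ≤ P := by omega
  rw [Qpoly_coeff_of_lt hP hQ (by omega) hPQ hPR hQR hu hl hul (T := 1) (by omega)]
  split_ifs with h
  · obtain ⟨m, rfl⟩ := Nat.exists_eq_add_of_le' h
    rw [Nat.add_sub_cancel]
    exact boxCount_sub_shift_mem hPQ hPQ' hR hPu hPu' m
  · have b1 := boxCount_one_le_one (R := R) (l := l) (c := 0) hPQ (by omega) hPu n
    have b2 := boxCount_one_le_one (R := R) (l := l') (c := 1) hPQ (by omega) hPu' n
    rw [abs_le]
    omega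

theorem Qpoly_coeff_self_eq_zero {P Q R : ℕ} (hP : P ≠ 0) (hPQ : P.Coprime Q)
    (hPR : P.Coprime R) (hQR : Q.Coprime R) {u l u' l' : ℕ} (hu : u + u' = P) (hl : l + l' = Q)
    (hul : u * Q + l * P = 1 + P * Q) (hP1 : 1 < P) (hPQ' : P < Q) (hPR' : P < R) :
    (Qpoly P Q R).coeff P = 0 := by
  have z : ∀ u l c, boxCount P Q R u l c 1 P = 0 := fun u l c => by
    by_contra h
    have := mod_lt_of_boxCount_one_ne_zero hPR'.le h
    rw [Nat.mod_eq_of_lt hPR'] at this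
    exact lt_irrefl _ this
  rw [Qpoly_coeff_of_lt hP (by omega) (by omega) hPQ hPR hQR hu hl hul (T := 1) (by nlinarith),
    z, z, if_neg (by omega)]
  simp

theorem exists_large_Qpoly_coeff {P Q R u l u' l' w v : ℕ} (hPQ : P.Coprime Q)
    (hPR : P.Coprime R) (hQR : Q.Coprime R) (hu : u + u' = P) (hl : l + l' = Q)
    (hul : u * Q + l * P = 1 + P * Q) (hu0 : 0 < u) (huP : 4 * u ≤ P) (huv : 2 * u ≤ v)
    (hvP : v + 2 * u ≤ P) (hw : 0 < w) (hPw : P * w < Q) (hR : 4 * (P * Q) ≤ R)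
    (hwv : (P : ℤ) ∣ w + v) (hwP : (P : ℤ) ∣ w * R + 1) (hwQ : (Q : ℤ) ∣ w * R - 1) :
    ∃ m : ℕ, (u : ℤ) ≤ (Qpoly P Q R).coeff m ∧ (Qpoly P Q R).coeff (m + Q) ≤ -u := by
  obtain ⟨u₀, rfl⟩ := Nat.exists_eq_add_of_lt hu0
  simp only [zero_add] at *
  have hP : 0 < P := by omega
  have hQ : 0 < Q := by omega
  have hPQ0 : 0 < P * Q := Nat.mul_pos hP hQ
  have hR0 : 0 < R := by omega
  have hPle : P ≤ P * Q := Nat.le_mul_of_pos_right _ hQ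
  have hQle : Q ≤ P * Q := Nat.le_mul_of_pos_left _ hP
  set y := 2 * Q * R * u₀ + P with hy
  set x := y / (P * Q) + 1 with hx
  have hx1 : y < P * Q * x := Nat.lt_mul_div_succ y hPQ0
  have hx2 : P * Q * x ≤ y + P * Q := by
    rw [hx, mul_add, mul_one]
    have := Nat.mul_div_le y (P * Q)
    omega
  set m := R * (P * w) + P * Q * x with hm
  have hRPw : R * (P * w) ≤ R * Q := Nat.mul_le_mul_left R hPw.le
  have hRQ : R ≤ R * Q := Nat.le_mul_of_pos_right _ hQ
  have hup : m + Q < 2 * (u₀ + 1) * Q * R := by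
    have : 2 * (u₀ + 1) * Q * R = 2 * Q * R * u₀ + 2 * (R * Q) := by ring
    omega
  have hlo : R * (2 * Q * (u₀ + 1) + P * w) + P ≤ m + 2 * Q * R := by
    have h1 : R * (2 * Q * (u₀ + 1) + P * w) = 2 * Q * R * u₀ + 2 * Q * R + R * (P * w) := by ring
    linarith
  have hQm : Q ≤ m := by
    have := Nat.le_mul_of_pos_right (P * Q) (show 0 < x from Nat.succ_pos _)
    omega
  have hmz : (m : ℤ) = R * P * w + P * Q * x := by rw [hm]; push_cast; ring
  set T := m + Q + 1 with hT
  have hTlt : m + Q < P * Q * T := by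
    have := Nat.le_mul_of_pos_left T hPQ0
    omega
  have c1 := le_boxCount (T := T) hPw hw hPQ hwP hwQ (by omega) hul hm hlo (by omega)
  have c2 := boxCount_neg_eq_zero (T := T) hPw hw hPQ hwv hwP hwQ huP hu hl hul hmz (by omega)
  have c3 := boxCount_pos_eq_zero (T := T) (l := l) (m := m + Q) (e := 1) (x := x) hPw hw hPQ hwv
    hwP hwQ huv hvP (by omega) (Or.inl rfl) (by push_cast; rw [hmz]; ring) hup
  have c4 := boxCount_pos_eq_zero (T := T) (l := l) (m := m - Q) (e := -1) (x := x) hPw hw hPQ hwv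
    hwP hwQ huv hvP (by omega) (Or.inr rfl) (by rw [Nat.cast_sub hQm, hmz]; ring) (by omega)
  refine ⟨m, ?_, ?_⟩
  · rw [Qpoly_coeff_of_lt hP.ne' hQ.ne' hR0.ne' hPQ hPR hQR hu hl hul (T := T) (by omega),
      if_pos hQm, c2, c4]
    omega
  · rw [Qpoly_coeff_of_lt hP.ne' hQ.ne' hR0.ne' hPQ hPR hQR hu hl hul (T := T) hTlt,
      if_pos (Nat.le_add_left _ _), Nat.add_sub_cancel, c2, c3]
    omega

theorem mem_coeffSet_of_abs_le {P Q R u l u' l' w v : ℕ} (hPQ : P.Coprime Q)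
    (hPR : P.Coprime R) (hQR : Q.Coprime R) (hu : u + u' = P) (hl : l + l' = Q)
    (hul : u * Q + l * P = 1 + P * Q) (hu0 : 0 < u) (huP : 4 * u ≤ P) (huv : 2 * u ≤ v)
    (hvP : v + 2 * u ≤ P) (hw : 0 < w) (hPw : P * w < Q) (hR : 4 * (P * Q) ≤ R)
    (hwv : (P : ℤ) ∣ w + v) (hwP : (P : ℤ) ∣ w * R + 1) (hwQ : (Q : ℤ) ∣ w * R - 1)
    {n : ℤ} (hn : |n| ≤ u) : n ∈ coeffSet P Q R := by
  have hP : P ≠ 0 := by omega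
  have hPltQ : P < Q := (Nat.le_mul_of_pos_right P hw).trans_lt hPw
  have hQ : Q ≠ 0 := by omega
  have hPQ0 : 0 < P * Q := by positivity
  have hPle : P ≤ P * Q := Nat.le_mul_of_pos_right _ (by omega)
  have hQle : Q ≤ P * Q := Nat.le_mul_of_pos_left _ (by omega)
  have hR0 : R ≠ 0 := by omega
  have of_coeff : ∀ m : ℕ, n ≠ 0 → (Qpoly P Q R).coeff m = n → n ∈ coeffSet P Q R := by
    rintro m hn0 rfl
    refine ⟨m, ?_, rfl⟩
    rw [← natDegree_Qpoly hP hQ hR0 hPQ hPR hQR]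
    exact le_natDegree_of_ne_zero hn0
  have walk : ∀ (m : ℕ) (σ : ℤ), σ = 1 ∨ σ = -1 → (u : ℤ) ≤ σ * (Qpoly P Q R).coeff m → 1 ≤ σ * n →
      σ * n ≤ u → n ∈ coeffSet P Q R := by
    intro m σ hσ hum h1 h2
    have base := abs_le.mp (abs_Qpoly_coeff_le_one_of_lt hP hQ hPQ hPR hQR hu hl hul hPltQ.le
      (by omega) (Nat.mod_lt m hPQ0))
    have step : ∀ t : ℕ, _ := fun t => abs_le.mp (Qpoly_coeff_step hP hQ hPQ hPR hQR hu hl hul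
      hPltQ.le (by omega : P + Q ≤ R) (m % (P * Q) + P * Q * t))
    obtain ⟨t, ht⟩ := exists_eq_of_step_le_one
      (f := fun t => σ * (Qpoly P Q R).coeff (m % (P * Q) + P * Q * t)) (N := m / (P * Q))
      (by rcases hσ with rfl | rfl <;> simp only [mul_zero, add_zero] <;> omega)
      (fun t => by
        have := step t
        rw [add_assoc, ← Nat.mul_succ] at this
        rcases hσ with rfl | rfl <;> simp only [Nat.succ_eq_add_one] at this ⊢ <;> omega)
      (by rw [Nat.mod_add_div]; exact hum) h1 h2
    refine of_coeff (m % (P * Q) + P * Q * t) ?_ ?_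
    · rintro rfl
      omega
    · rcases hσ with rfl | rfl <;> omega
  obtain ⟨m, hm1, hm2⟩ := exists_large_Qpoly_coeff hPQ hPR hQR hu hl hul hu0 huP huv hvP hw hPw hR
    hwv hwP hwQ
  have hn' := abs_le.mp hn
  rcases lt_trichotomy n 0 with h | rfl | h
  · exact walk (m + Q) (-1) (Or.inr rfl) (by omega) (by omega) (by omega)
  · refine ⟨P, ?_, Qpoly_coeff_self_eq_zero hP hPQ hPR hQR hu hl hul (by omega) hPltQ (by omega)⟩
    calc P ≤ 1 * (Q - 1) * 1 := by omega
      _ ≤ (P - 1) * (Q - 1) * (R - 1) := by gcongr <;> omega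
  · exact walk m 1 (Or.inl rfl) (by omega) (by omega) (by omega)

theorem exists_coprime_inverses {P Q u : ℕ} (hQ : Q ≠ 0) (hu : 0 < u) (huP : u < P)
    (h : (P : ℤ) ∣ u * Q - 1) : ∃ l l' : ℕ, l + l' = Q ∧ u * Q + l * P = 1 + P * Q := by
  obtain ⟨k, hk⟩ := h
  have hP : (0 : ℤ) < P := by omega
  have hQ' : (0 : ℤ) < Q := by omega
  have huP' : (u : ℤ) < P := by omega
  have hk0 : 0 ≤ k := by
    by_contra! hneg
    nlinarith [mul_pos (Int.natCast_pos.mpr hu) hQ']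
  have hkQ : k ≤ Q := by
    by_contra! hlt
    nlinarith
  lift k to ℕ using hk0
  refine ⟨Q - k, k, by omega, ?_⟩
  zify [show k ≤ Q by omega]
  linarith

theorem exists_pow_parameters {p q r : ℕ} (hp : p.Prime) (hq : q.Prime) (hr : r.Prime)
    (hpq : p ≠ q) (hpr : p ≠ r) (hqr : q ≠ r) :
    ∃ K : ℕ, ∀ a u v : ℕ, K ≤ a → u < p ^ a → v ≤ p ^ a → p ^ K ∣ u - 1 → p ^ K ∣ v - 1 →
      1 ≤ u → 1 ≤ v → ∃ b c w l l' : ℕ, l + l' = q ^ b ∧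
        u * q ^ b + l * p ^ a = 1 + p ^ a * q ^ b ∧ 0 < w ∧ p ^ a * w < q ^ b ∧
        4 * (p ^ a * q ^ b) ≤ r ^ c ∧ ((p ^ a : ℕ) : ℤ) ∣ w + v ∧
        ((p ^ a : ℕ) : ℤ) ∣ w * (r ^ c : ℕ) + 1 ∧ ((q ^ b : ℕ) : ℤ) ∣ w * (r ^ c : ℕ) - 1 := by
  obtain ⟨K₁, L₁, h₁⟩ := exists_pow_modEq_inv hp hr hq hpr hpq hqr.symm
  obtain ⟨K₂, L, h₂⟩ := exists_pow_modEq_inv hp hq hr hpq hpr hqr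
  refine ⟨K₁ + K₂, fun a u v ha hu hv hdu hdv hu1 hv1 => ?_⟩
  have hdvd : ∀ {x : ℕ} {k : ℕ}, k ≤ K₁ + K₂ → p ^ (K₁ + K₂) ∣ x - 1 → 1 ≤ x →
      (p : ℤ) ^ k ∣ x - 1 := fun hk h hx => by
    have := (pow_dvd_pow p hk).trans h
    zify [hx] at this
    exact this
  have hcop : (p ^ a).Coprime (q ^ L) := ((Nat.coprime_primes hp hq).mpr hpq).pow a L
  obtain ⟨w₀, hwp, hwq⟩ := Nat.chineseRemainder hcop (p ^ a - v) 1
  set w := w₀ + p ^ a * q ^ L with hw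
  have hw0 : 0 < w := by
    have := pow_pos hp.pos a
    have := pow_pos hq.pos L
    positivity
  have hwv : ((p ^ a : ℕ) : ℤ) ∣ w + v := by
    have : w + v ≡ 0 [MOD p ^ a] := by
      have h0 : w ≡ p ^ a - v [MOD p ^ a] := by
        rw [hw]
        exact Nat.add_modulus_mul_modEq_iff.mpr hwp
      have := h0.add_right v
      rw [Nat.sub_add_cancel hv] at this
      exact this.trans (by simp [Nat.ModEq])
    exact_mod_cast (Nat.modEq_zero_iff_dvd.mp this)
  have hwL : (q : ℤ) ^ L ∣ w - 1 := by
    have h0 : w ≡ 1 [MOD q ^ L] := by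
      rw [hw]
      exact Nat.add_mul_modulus_modEq_iff.mpr hwq
    have := (Nat.modEq_iff_dvd.mp h0.symm)
    exact_mod_cast this
  obtain ⟨b, hb, hbp, -⟩ := h₁ a 0 u 1 (hdvd (by omega) hdu hu1) (by simp) (p ^ a * w)
  obtain ⟨c, hc, hcp, hcq⟩ := h₂ a b v w (hdvd (by omega) hdv hv1) hwL (4 * (p ^ a * q ^ b))
  obtain ⟨l, l', hl, hul⟩ := exists_coprime_inverses (P := p ^ a) (Q := q ^ b)
    (pow_ne_zero _ hq.ne_zero) hu1 hu (by exact_mod_cast hbp)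
  refine ⟨b, c, w, l, l', hl, hul, hw0, hb.trans (Nat.lt_pow_self hq.one_lt),
    (hc.trans (Nat.lt_pow_self hr.one_lt)).le, hwv, ?_, by exact_mod_cast hcq⟩
  have := (hwv.mul_right (r ^ c : ℕ)).sub (show ((p ^ a : ℕ) : ℤ) ∣ v * (r ^ c : ℕ) - 1 by
    exact_mod_cast hcp)
  rwa [show (w : ℤ) * (r ^ c : ℕ) + 1 = (w + v) * (r ^ c : ℕ) - (v * (r ^ c : ℕ) - 1) by ring]

theorem exists_residues_near {m P : ℕ} (hm : 0 < m) (hP : m + 4 ≤ P) :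
    ∃ u v : ℕ, 0 < u ∧ 4 * u + m ≤ P ∧ P < 4 * u + 5 * m ∧ 2 * u ≤ v ∧ v + 2 * u ≤ P ∧
      m ∣ u - 1 ∧ m ∣ v - 1 := by
  obtain ⟨s, rfl⟩ := Nat.exists_eq_add_of_le hP
  have h1 := Nat.div_mul_le_self s (4 * m)
  have h2 := Nat.lt_div_mul_add (a := s) (show 0 < 4 * m by omega)
  set k := s / (4 * m)
  refine ⟨1 + m * k, 1 + m * (2 * k + 1), by omega, ?_, ?_, ?_, ?_, by simp, by simp⟩ <;>
    linarith

theorem stmt_0 (p q r : ℕ) (hp : p.Prime) (hq : q.Prime) (hr : r.Prime)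
    (hpq : p ≠ q) (hpr : p ≠ r) (hqr : q ≠ r) :
    ∀ ε : ℝ, 0 < ε → ∃ aε : ℕ, ∀ a : ℕ, aε ≤ a →
      ∃ b c : ℕ, 0 < b ∧ 0 < c ∧ 2 < p ^ a ∧ 2 < q ^ b ∧ 2 < r ^ c ∧
        ∀ n : ℤ, (|n| : ℝ) ≤ (1 / 4 - ε) * (p : ℝ) ^ a →
          n ∈ coeffSet (p ^ a) (q ^ b) (r ^ c) := by
  intro ε hε
  obtain ⟨K, hK⟩ := exists_pow_parameters hp hq hr hpq hpr hqr
  refine ⟨K + p ^ K + 4 + ⌈2 * (p : ℝ) ^ K / ε⌉₊, fun a ha => ?_⟩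
  have haP : a < p ^ a := Nat.lt_pow_self hp.one_lt
  have hεP : 2 * (p : ℝ) ^ K ≤ p ^ a * ε := by
    rw [← div_le_iff₀ hε]
    calc _ ≤ (⌈2 * (p : ℝ) ^ K / ε⌉₊ : ℝ) := Nat.le_ceil _
      _ ≤ (p ^ a : ℕ) := Nat.cast_le.mpr (by omega)
      _ = _ := by push_cast; rfl
  obtain ⟨u, v, hu0, hu1, hu2, huv, hvP, hdu, hdv⟩ :=
    exists_residues_near (m := p ^ K) (P := p ^ a) (pow_pos hp.pos K) (by omega)
  obtain ⟨b, c, w, l, l', hl, hul, hw, hPw, hR, hwv, hwP, hwQ⟩ :=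
    hK a u v (by omega) (by omega) (by omega) hdu hdv hu0 (by omega)
  have hPQ := Nat.le_mul_of_pos_right (p ^ a) hw
  have hQR := Nat.le_mul_of_pos_left (q ^ b) (show 0 < p ^ a by omega)
  have hb : b ≠ 0 := by
    rintro rfl
    rw [pow_zero] at *
    omega
  have hc : c ≠ 0 := by
    rintro rfl
    rw [pow_zero] at *
    omega
  refine ⟨b, c, hb.bot_lt, hc.bot_lt, by omega, by omega, by omega, fun n hn => ?_⟩
  refine mem_coeffSet_of_abs_le (((Nat.coprime_primes hp hq).mpr hpq).pow a b)
    (((Nat.coprime_primes hp hr).mpr hpr).pow a c) (((Nat.coprime_primes hq hr).mpr hqr).pow b c)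
    (Nat.add_sub_of_le (by omega)) hl hul hu0 (by omega) huv hvP hw hPw hR hwv hwP hwQ ?_
  have hu2' : (p : ℝ) ^ a < 4 * u + 5 * p ^ K := by exact_mod_cast hu2
  have hpK : (0 : ℝ) < p ^ K := pow_pos (by exact_mod_cast hp.pos) K
  have : (|n| : ℝ) ≤ u := by linarith
  exact_mod_cast this
end

section
/- Fix an arbitrary triple of distinct primes p, q, r. For every ε > 0 there exists a_ε such that for all exponents a ≥ a_ε: (1) there exist positive integers b and c (with p^a, q^b, r^c > 2) such that A_{p^a,q^b,r^c} contains every integer n with −1 ≤ n ≤ (1/2 − ε)·p^a, and (2) there exist positive integers b' and c' such that A_{p^a,q^{b'},r^{c'}} contains every integer n with −(1/2 − ε)·p^a ≤ n ≤ 1. -/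
open Polynomial

theorem exists_pow_modEq_of_eq_one_add {p m y : ℕ} (hp : p.Prime) (hm : 2 ≤ m) (hy : ¬ p ∣ y)
    (a : ℕ) {u : ℕ} (hu : u ≡ 1 [MOD p ^ m]) : ∃ c, (1 + p ^ m * y) ^ c ≡ u [MOD p ^ a] := by
  rcases le_total a m with ham | ham
  · exact ⟨0, by simpa using (hu.of_dvd (pow_dvd_pow p ham)).symm⟩
  obtain ⟨n, rfl⟩ := Nat.exists_eq_add_of_le' ham
  have hpm : 1 < p ^ m := Nat.one_lt_pow (by omega) hp.one_lt
  have hrep : ∀ v : ℕ, v ≡ 1 [MOD p ^ m] → ∃ z, v = 1 + p ^ m * z := by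
    intro v hv
    have h1 : 1 ≤ v := by
      rcases Nat.eq_zero_or_pos v with rfl | h
      · have := (Nat.modEq_zero_iff_dvd.1 hv.symm)
        exact absurd (Nat.le_of_dvd one_pos this) (by omega)
      · exact h
    obtain ⟨z, hz⟩ := (Nat.modEq_iff_dvd' h1).1 hv.symm
    exact ⟨z, by omega⟩
  set S := (Finset.range (p ^ n)).image fun z : ℕ ↦ (1 + p ^ m * z : ZMod (p ^ (n + m)))
  set C := (Finset.range (p ^ n)).image fun c : ℕ ↦ ((1 + p ^ m * y : ZMod (p ^ (n + m)))) ^ c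
  have hS : ∀ v : ℕ, v ≡ 1 [MOD p ^ m] → (v : ZMod (p ^ (n + m))) ∈ S := by
    intro v hv
    obtain ⟨z, rfl⟩ := hrep v hv
    refine Finset.mem_image.2 ⟨z % p ^ n, Finset.mem_range.2 (Nat.mod_lt _ (pow_pos hp.pos _)), ?_⟩
    have h0 : ((p ^ (n + m) : ℕ) : ZMod (p ^ (n + m))) = 0 := ZMod.natCast_self _
    conv_rhs => rw [← Nat.mod_add_div z (p ^ n)]
    push_cast at h0 ⊢
    linear_combination (-((z / p ^ n : ℕ) : ZMod (p ^ (n + m)))) * h0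
  have hord : orderOf (1 + p ^ m * y : ZMod (p ^ (n + m))) = p ^ n := by
    have := ZMod.orderOf_one_add_mul_prime_pow hp m (by omega) (by nlinarith [hp.two_le]) (y : ℤ)
      (by exact_mod_cast hy) n
    simpa using this
  have hCS : C ⊆ S := by
    intro x hx
    obtain ⟨c, -, rfl⟩ := Finset.mem_image.1 hx
    have := hS ((1 + p ^ m * y) ^ c) (by
      have : 1 + p ^ m * y ≡ 1 [MOD p ^ m] := by simp [Nat.ModEq]
      simpa using this.pow c)
    simpa using this
  have hC : C.card = p ^ n := by
    have hinj : Set.InjOn (fun c : ℕ ↦ ((1 + p ^ m * y : ZMod (p ^ (n + m)))) ^ c)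
        (Finset.range (p ^ n)) := fun i hi j hj h ↦
      pow_injOn_Iio_orderOf (by simpa [hord] using hi) (by simpa [hord] using hj) h
    rw [Finset.card_image_of_injOn hinj, Finset.card_range]
  have hcard : S.card ≤ C.card := hC ▸ Finset.card_image_le.trans (Finset.card_range _).le
  have := hS u hu
  rw [← Finset.eq_of_subset_of_card_le hCS hcard] at this
  obtain ⟨c, -, hc⟩ := Finset.mem_image.1 this
  exact ⟨c, (ZMod.natCast_eq_natCast_iff _ _ _).1 (by simpa using hc)⟩

theorem exists_one_add_pow_eq (x d : ℕ) : ∃ z, (1 + x) ^ d = 1 + d * x + x ^ 2 * z := by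
  induction d with
  | zero => exact ⟨0, by simp⟩
  | succ d ih =>
    obtain ⟨z, hz⟩ := ih
    exact ⟨d + z + x * z, by rw [pow_succ, hz]; ring⟩

theorem exists_pow_mul_modEq {p r f : ℕ} (hp : p.Prime) (hr : 1 < r) (hpr : r.Coprime p)
    (hf : 0 < f) : ∃ k, ∀ d, d.Coprime p → ∀ a u, u ≡ 1 [MOD p ^ k] →
      ∃ c, r ^ (f * d * c) ≡ u [MOD p ^ a] := by
  set e := f * Nat.totient (p ^ 2)
  have he : e ≠ 0 := (Nat.mul_pos hf (Nat.totient_pos.2 (pow_pos hp.pos 2))).ne'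
  have hre : 1 < r ^ e := Nat.one_lt_pow he hr
  obtain ⟨k, y, hy, hk⟩ :=
    Nat.exists_eq_pow_mul_and_not_dvd (n := r ^ e - 1) (by omega) p hp.ne_one
  have hek : r ^ e = 1 + p ^ k * y := by omega
  have hk2 : 2 ≤ k := by
    have h1 : r ^ e ≡ 1 [MOD p ^ 2] := by
      have := (Nat.ModEq.pow_totient (hpr.pow_right 2)).pow f
      rwa [← pow_mul, one_pow, mul_comm] at this
    have h2 : p ^ 2 ∣ p ^ k * y := hk ▸ (Nat.modEq_iff_dvd' hre.le).1 h1.symm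
    by_contra h
    have h3 : p ^ 2 = p ^ k * p ^ (2 - k) := by rw [← pow_add]; congr 1; omega
    rw [h3] at h2
    exact hy ((dvd_pow_self p (by omega)).trans (Nat.dvd_of_mul_dvd_mul_left (pow_pos hp.pos k) h2))
  refine ⟨k, fun d hd a u hu ↦ ?_⟩
  obtain ⟨z, hz⟩ := exists_one_add_pow_eq (p ^ k * y) d
  have hg : r ^ (e * d) = 1 + p ^ k * (d * y + p ^ k * (y ^ 2 * z)) := by
    rw [pow_mul, hek, hz]; ring
  have hndvd : ¬ p ∣ d * y + p ^ k * (y ^ 2 * z) := by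
    rw [← Nat.dvd_add_iff_left (Dvd.dvd.mul_right (dvd_pow_self p (by omega)) _)]
    intro h
    rcases (hp.dvd_mul).1 h with h | h
    · exact hp.one_lt.ne' (Nat.dvd_one.1 (hd ▸ Nat.dvd_gcd h dvd_rfl))
    · exact hy h
  obtain ⟨c, hc⟩ := exists_pow_modEq_of_eq_one_add hp hk2 hndvd a hu
  refine ⟨Nat.totient (p ^ 2) * c, ?_⟩
  rw [← hg, ← pow_mul] at hc
  convert hc using 2
  simp only [e]; ring

theorem exists_pow_modEq_prime_pow_mul {p q r : ℕ} (hp : p.Prime) (hq : q.Prime) (hr : 1 < r)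
    (hpq : p ≠ q) (hpr : r.Coprime p) (hqr : r.Coprime q) :
    ∃ k l, ∀ a b u, 0 < a → 0 < b → u ≡ 1 [MOD p ^ k] → u ≡ 1 [MOD q ^ l] →
      ∃ c, r ^ c ≡ u [MOD p ^ a * q ^ b] := by
  have hcop : p.Coprime q := (Nat.coprime_primes hp hq).2 hpq
  obtain ⟨k, hk⟩ := exists_pow_mul_modEq (f := q - 1) hp hr hpr (by have := hq.two_le; omega)
  obtain ⟨l, hl⟩ := exists_pow_mul_modEq (f := p - 1) hq hr hqr (by have := hp.two_le; omega)
  refine ⟨k, l, fun a b u ha hb hup huq ↦ ?_⟩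
  obtain ⟨c, hc⟩ := hk (q ^ (b - 1)) (hcop.symm.pow_left _) a u hup
  obtain ⟨d, hd⟩ := hl (p ^ (a - 1)) (hcop.pow_left _) b u huq
  have hc1 : r ^ ((q - 1) * q ^ (b - 1) * c) ≡ 1 [MOD q ^ b] := by
    have := (Nat.ModEq.pow_totient (hqr.pow_right b)).pow c
    rwa [Nat.totient_prime_pow hq hb, ← pow_mul, one_pow, mul_comm (q ^ (b - 1))] at this
  have hd1 : r ^ ((p - 1) * p ^ (a - 1) * d) ≡ 1 [MOD p ^ a] := by
    have := (Nat.ModEq.pow_totient (hpr.pow_right a)).pow d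
    rwa [Nat.totient_prime_pow hp ha, ← pow_mul, one_pow, mul_comm (p ^ (a - 1))] at this
  refine ⟨(q - 1) * q ^ (b - 1) * c + (p - 1) * p ^ (a - 1) * d, ?_⟩
  rw [← Nat.modEq_and_modEq_iff_modEq_mul (Nat.Coprime.pow a b hcop), pow_add]
  exact ⟨by simpa using hc.mul hd1, by simpa using hc1.mul hd⟩

theorem prod_map_cyclotomic_divisors {n : ℕ} (hn : 0 < n) :
    (n.divisors.val.map fun d ↦ cyclotomic d ℤ).prod = X ^ n - 1 :=
  prod_cyclotomic_eq_X_pow_sub_one hn ℤ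

theorem count_divisors {n : ℕ} (hn : 0 < n) (d : ℕ) :
    n.divisors.val.count d = if d ∣ n then 1 else 0 := by
  rw [Multiset.count_eq_of_nodup n.divisors.nodup]
  simp [hn.ne']

theorem X_pow_sub_one_mul_dvd {p q : ℕ} (hp : 0 < p) (hq : 0 < q) (h : p.Coprime q) :
    ((X ^ p - 1) * (X ^ q - 1) : ℤ[X]) ∣ (X ^ (p * q) - 1) * (X - 1) := by
  have h1 := prod_map_cyclotomic_divisors one_pos
  rw [pow_one] at h1
  rw [← h1]
  simp only [← prod_map_cyclotomic_divisors, hp, hq, Nat.mul_pos, ← Multiset.prod_add,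
    ← Multiset.map_add]
  refine Multiset.prod_dvd_prod_of_le (Multiset.map_le_map (Multiset.le_iff_count.2 fun d ↦ ?_))
  simp only [Multiset.count_add, count_divisors, hp, hq, Nat.mul_pos, one_pos, Nat.dvd_one]
  have e1 : d ∣ p → d ∣ q → d = 1 := fun a b ↦ Nat.dvd_one.1 (h ▸ Nat.dvd_gcd a b)
  have e2 : d ∣ p → d ∣ p * q := fun a ↦ a.mul_right q
  have e3 : d ∣ q → d ∣ p * q := fun a ↦ a.mul_left p
  split_ifs <;> simp_all

theorem ternary_denominator_dvd {p q r : ℕ} (hp : 0 < p) (hq : 0 < q) (hr : 0 < r)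
    (hpq : p.Coprime q) (hqr : q.Coprime r) (hrp : r.Coprime p) :
    ((X ^ (p * q) - 1) * (X ^ (q * r) - 1) * (X ^ (r * p) - 1) * (X - 1) : ℤ[X]) ∣
      (X ^ (p * q * r) - 1) * (X ^ p - 1) * (X ^ q - 1) * (X ^ r - 1) := by
  have h1 := prod_map_cyclotomic_divisors one_pos
  rw [pow_one] at h1
  rw [← h1]
  have hpqr := Nat.mul_pos (Nat.mul_pos hp hq) hr
  simp only [← prod_map_cyclotomic_divisors, hp, hq, hr, hpqr, Nat.mul_pos, ← Multiset.prod_add,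
    ← Multiset.map_add]
  refine Multiset.prod_dvd_prod_of_le (Multiset.map_le_map (Multiset.le_iff_count.2 fun d ↦ ?_))
  simp only [Multiset.count_add, count_divisors, hp, hq, hr, hpqr, Nat.mul_pos, one_pos, Nat.dvd_one]
  have gcd_mul : ∀ {x y z : ℕ}, Nat.Coprime z x → d ∣ x * y → d ∣ y * z → d ∣ y := by
    intro x y z hzx h1 h2
    have := Nat.dvd_gcd h1 h2
    rwa [mul_comm x y, Nat.gcd_mul_left, hzx.symm.gcd_eq_one, mul_one] at this
  have e1 : d ∣ p * q → d ∣ q * r → d ∣ q := gcd_mul hrp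
  have e2 : d ∣ q * r → d ∣ r * p → d ∣ r := gcd_mul hpq
  have e3 : d ∣ r * p → d ∣ p * q → d ∣ p := gcd_mul hqr
  have e4 : d ∣ p → d ∣ q → d = 1 := fun a b ↦ Nat.dvd_one.1 (hpq ▸ Nat.dvd_gcd a b)
  have e5 : d ∣ p * q → d ∣ p * q * r := fun a ↦ a.mul_right r
  have e6 : d ∣ q * r → d ∣ p * q * r := fun a ↦ by rw [mul_assoc]; exact a.mul_left p
  have e7 : d ∣ r * p → d ∣ p * q * r := fun a ↦ by
    rw [show p * q * r = r * p * q by ring]; exact a.mul_right q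
  by_cases hd : d = 1
  · subst hd; simp
  by_cases f1 : d ∣ p * q <;> by_cases f2 : d ∣ q * r <;> by_cases f3 : d ∣ r * p <;>
    simp only [f1, f2, f3, hd, true_imp_iff, false_imp_iff, if_true, if_false]
      at e1 e2 e3 e4 e5 e6 e7 ⊢ <;>
    simp_all <;> omega

theorem Qpoly_mul_s2 {p q r : ℕ} (hp : 0 < p) (hq : 0 < q) (hr : 0 < r)
    (hpq : p.Coprime q) (hqr : q.Coprime r) (hrp : r.Coprime p) :
    ((X ^ (p * q) - 1) * (X ^ (q * r) - 1) * (X ^ (r * p) - 1) * (X - 1)) * Qpoly p q r =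
      (X ^ (p * q * r) - 1) * (X ^ p - 1) * (X ^ q - 1) * (X ^ r - 1) := by
  have hmonic : ∀ {n : ℕ}, 0 < n → (X ^ n - 1 : ℤ[X]).Monic := fun hn ↦ by
    simpa using monic_X_pow_sub_C (1 : ℤ) hn.ne'
  have hm := (((hmonic (Nat.mul_pos hp hq)).mul (hmonic (Nat.mul_pos hq hr))).mul
    (hmonic (Nat.mul_pos hr hp))).mul (pow_one (X : ℤ[X]) ▸ hmonic one_pos)
  have h := modByMonic_add_div ((X ^ (p * q * r) - 1) * (X ^ p - 1) * (X ^ q - 1) * (X ^ r - 1))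
    ((X ^ (p * q) - 1) * (X ^ (q * r) - 1) * (X ^ (r * p) - 1) * (X - 1) : ℤ[X])
  rwa [(modByMonic_eq_zero_iff_dvd hm).2 (ternary_denominator_dvd hp hq hr hpq hqr hrp),
    zero_add] at h

theorem natDegree_Qpoly_s2 {p q r : ℕ} (hp : 0 < p) (hq : 0 < q) (hr : 0 < r)
    (hpq : p.Coprime q) (hqr : q.Coprime r) (hrp : r.Coprime p) :
    (Qpoly p q r).natDegree = (p - 1) * (q - 1) * (r - 1) := by
  have hmonic : ∀ {n : ℕ}, 0 < n → (X ^ n - 1 : ℤ[X]).Monic := fun hn ↦ by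
    simpa using monic_X_pow_sub_C (1 : ℤ) hn.ne'
  have hdeg : ∀ n : ℕ, (X ^ n - 1 : ℤ[X]).natDegree = n := fun n ↦ by
    simpa using natDegree_X_pow_sub_C (n := n) (r := (1 : ℤ))
  have hX : (X - 1 : ℤ[X]).Monic := pow_one (X : ℤ[X]) ▸ hmonic one_pos
  have hXd : (X - 1 : ℤ[X]).natDegree = 1 := pow_one (X : ℤ[X]) ▸ hdeg 1
  have h1 := hmonic (Nat.mul_pos hp hq)
  have h2 := hmonic (Nat.mul_pos hq hr)
  have h3 := hmonic (Nat.mul_pos hr hp)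
  have h4 := hmonic (Nat.mul_pos (Nat.mul_pos hp hq) hr)
  have hden := ((h1.mul h2).mul h3).mul hX
  have key := congrArg natDegree (Qpoly_mul_s2 hp hq hr hpq hqr hrp)
  have hQ : (Qpoly p q r) ≠ 0 := by
    intro h
    have := Qpoly_mul_s2 hp hq hr hpq hqr hrp
    rw [h, mul_zero] at this
    exact (((h4.mul (hmonic hp)).mul (hmonic hq)).mul (hmonic hr)).ne_zero this.symm
  rw [hden.natDegree_mul' hQ, ((h1.mul h2).mul h3).natDegree_mul hX, (h1.mul h2).natDegree_mul h3,
    h1.natDegree_mul h2, ((h4.mul (hmonic hp)).mul (hmonic hq)).natDegree_mul (hmonic hr),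
    (h4.mul (hmonic hp)).natDegree_mul (hmonic hq), h4.natDegree_mul (hmonic hp)] at key
  simp only [hdeg, hXd] at key
  obtain ⟨p, rfl⟩ := Nat.exists_eq_add_of_le' hp
  obtain ⟨q, rfl⟩ := Nat.exists_eq_add_of_le' hq
  obtain ⟨r, rfl⟩ := Nat.exists_eq_add_of_le' hr
  simp only [Nat.add_sub_cancel]
  zify at key ⊢
  linear_combination key

theorem mem_coeffSet_of_ne_zero {p q r m : ℕ} (hp : 0 < p) (hq : 0 < q) (hr : 0 < r)
    (hpq : p.Coprime q) (hqr : q.Coprime r) (hrp : r.Coprime p)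
    (h : (Qpoly p q r).coeff m ≠ 0) : (Qpoly p q r).coeff m ∈ coeffSet p q r :=
  ⟨m, natDegree_Qpoly_s2 hp hq hr hpq hqr hrp ▸ le_natDegree_of_ne_zero h, rfl⟩

/-- `1` if `i` lies in the numerical semigroup generated by `p` and `q`, `0` otherwise; here `l` is
an inverse of `q` modulo `p`. -/
def semigroupIndicator (p q l i : ℕ) : ℤ := if i * l % p * q ≤ i then 1 else 0

theorem mk_periodic_mul {N p : ℕ} (hN : p ≤ N) :
    PowerSeries.mk (fun n ↦ if n % N < p then (1 : ℤ) else 0) * (1 - PowerSeries.X ^ N) =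
      ∑ i ∈ Finset.range p, PowerSeries.X ^ i := by
  ext n
  rw [mul_sub, mul_one, map_sub, PowerSeries.coeff_mul_X_pow', map_sum]
  simp only [PowerSeries.coeff_mk, PowerSeries.coeff_X_pow, Finset.sum_ite_eq, Finset.mem_range]
  by_cases h : N ≤ n
  · have h1 : (n - N) % N = n % N := (Nat.mod_eq_sub_mod h).symm
    have h2 : ¬ n < p := by omega
    simp [h, h1, h2]
  · simp [h, Nat.mod_eq_of_lt (not_le.1 h)]

theorem mk_semigroupIndicator_mul {p q l : ℕ} (hp : 0 < p) (hl : l * q ≡ 1 [MOD p]) :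
    PowerSeries.mk (semigroupIndicator p q l) * (1 - PowerSeries.X ^ p) =
      ∑ y ∈ Finset.range p, (PowerSeries.X ^ q) ^ y := by
  ext n
  rw [mul_sub, mul_one, map_sub, PowerSeries.coeff_mul_X_pow', map_sum]
  simp only [PowerSeries.coeff_mk, ← pow_mul, PowerSeries.coeff_X_pow, semigroupIndicator]
  have hy : n * l % p * q ≡ n [MOD p] := by
    have := ((Nat.mod_modEq (n * l) p).mul_right q).trans (by simpa [mul_assoc] using hl.mul_left n)
    exact this
  have hlt : n * l % p < p := Nat.mod_lt _ hp
  have huniq : ∀ y < p, n = q * y → y = n * l % p := by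
    rintro y hlt' rfl
    have h1 : y ≡ q * y * l [MOD p] := by
      have := (hl.mul_left y).symm
      rw [mul_one] at this
      convert this using 1; ring
    exact (Nat.mod_eq_of_lt hlt').symm.trans h1
  have hsum : (∑ y ∈ Finset.range p, if n = q * y then (1 : ℤ) else 0) =
      if n = n * l % p * q then 1 else 0 := by
    rw [Finset.sum_eq_single (n * l % p)]
    · rw [mul_comm q]
    · intro y hy hne
      exact if_neg fun h ↦ hne (huniq y (Finset.mem_range.1 hy) h)
    · intro h; exact absurd (Finset.mem_range.2 hlt) h
  rw [hsum]
  by_cases h : p ≤ n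
  · have h1 : (n - p) * l % p = n * l % p := by
      refine Nat.ModEq.mul_right l ?_
      exact (Nat.mod_eq_sub_mod h).symm
    rw [if_pos h, h1]
    generalize n * l % p * q = v at *
    by_cases h2 : v ≤ n
    · obtain ⟨z, hz⟩ := (Nat.modEq_iff_dvd' h2).1 hy
      rcases Nat.eq_zero_or_pos z with rfl | hz0
      · have : v = n := by omega
        subst this
        simp; omega
      · have : p ≤ p * z := Nat.le_mul_of_pos_right _ hz0
        rw [if_pos h2, if_pos (by omega), if_neg (by omega)]; rfl
    · rw [if_neg h2, if_neg (by omega), if_neg (by omega)]; rfl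
  · rw [if_neg h, sub_zero]
    generalize n * l % p * q = v at *
    refine if_congr ⟨fun h2 ↦ ?_, fun h ↦ h.ge⟩ rfl rfl
    obtain ⟨z, hz⟩ := (Nat.modEq_iff_dvd' h2).1 hy
    rcases Nat.eq_zero_or_pos z with rfl | hz0
    · omega
    · have : p ≤ p * z := Nat.le_mul_of_pos_right _ hz0
      omega

/-- The binary inclusion-exclusion polynomial has the coefficient pattern of its semigroup. -/
theorem exists_binary_polynomial {p q l : ℕ} (hp : 0 < p) (hq : 0 < q) (h : p.Coprime q)
    (hl : l * q ≡ 1 [MOD p]) : ∃ F : ℤ[X],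
      (X ^ p - 1) * (X ^ q - 1) * F = (X ^ (p * q) - 1) * (X - 1) ∧
      ∀ i, F.coeff (i + 1) = semigroupIndicator p q l (i + 1) - semigroupIndicator p q l i := by
  obtain ⟨F, hF⟩ := X_pow_sub_one_mul_dvd hp hq h
  refine ⟨F, hF.symm, fun i ↦ ?_⟩
  have hFs : (PowerSeries.X ^ (p * q) - 1) * (PowerSeries.X - 1) =
      (PowerSeries.X ^ p - 1) * (PowerSeries.X ^ q - 1) * (F : PowerSeries ℤ) := by
    have := congrArg (fun f : ℤ[X] ↦ (f : PowerSeries ℤ)) hF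
    simpa using this
  have hne : ∀ {n : ℕ}, 0 < n → (PowerSeries.X ^ n - 1 : PowerSeries ℤ) ≠ 0 := by
    intro n hn h0
    have := congrArg (PowerSeries.coeff 0) h0
    simp [hn.ne'] at this
  have hgeom := geom_sum_mul (PowerSeries.X ^ q : PowerSeries ℤ) p
  rw [← mk_semigroupIndicator_mul hp hl, ← pow_mul, mul_comm q p] at hgeom
  have hG : (F : PowerSeries ℤ) =
      PowerSeries.mk (semigroupIndicator p q l) * (1 - PowerSeries.X) := by
    apply mul_left_cancel₀ (mul_ne_zero (hne hp) (hne hq))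
    rw [← hFs, ← hgeom]
    ring
  rw [← Polynomial.coeff_coe, hG, mul_sub, mul_one, map_sub, PowerSeries.coeff_succ_mul_X]
  simp

theorem Qpoly_coe_eq {p q r : ℕ} (hp : 0 < p) (hq : 1 < q) (hr : 0 < r)
    (hpq : p.Coprime q) (hqr : q.Coprime r) (hrp : r.Coprime p) {F : ℤ[X]}
    (hF : (X ^ p - 1) * (X ^ q - 1) * F = (X ^ (p * q) - 1) * (X - 1)) :
    (Qpoly p q r : PowerSeries ℤ) = (expand ℤ r F : PowerSeries ℤ) *
      PowerSeries.mk (fun n ↦ if n % (p * q) < p then (1 : ℤ) else 0) *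
        (1 - PowerSeries.X ^ q) := by
  have hne : ∀ {n : ℕ}, 0 < n → (PowerSeries.X ^ n - 1 : PowerSeries ℤ) ≠ 0 := by
    intro n hn h0
    have := congrArg (PowerSeries.coeff 0) h0
    simp [hn.ne'] at this
  have h1 : (PowerSeries.X ^ (p * r) - 1) * (PowerSeries.X ^ (q * r) - 1) *
      (expand ℤ r F : PowerSeries ℤ) =
      (PowerSeries.X ^ (p * q * r) - 1) * (PowerSeries.X ^ r - 1) := by
    have := congrArg (fun f : ℤ[X] ↦ (expand ℤ r f : PowerSeries ℤ)) hF
    simpa [← pow_mul, mul_comm, mul_left_comm] using this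
  have h2 : (PowerSeries.X ^ (p * q) - 1) * (PowerSeries.X ^ (q * r) - 1) *
      (PowerSeries.X ^ (r * p) - 1) * (PowerSeries.X - 1) * (Qpoly p q r : PowerSeries ℤ) =
      (PowerSeries.X ^ (p * q * r) - 1) * (PowerSeries.X ^ p - 1) * (PowerSeries.X ^ q - 1) *
      (PowerSeries.X ^ r - 1) := by
    have := congrArg (fun f : ℤ[X] ↦ (f : PowerSeries ℤ))
      (Qpoly_mul_s2 hp (by omega) hr hpq hqr hrp)
    simpa using this
  have h3 := mk_periodic_mul (N := p * q) (p := p) (Nat.le_mul_of_pos_right _ (by omega))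
  have h4 := geom_sum_mul (PowerSeries.X : PowerSeries ℤ) p
  rw [← h3] at h4
  have hX : (PowerSeries.X - 1 : PowerSeries ℤ) ≠ 0 :=
    pow_one (PowerSeries.X : PowerSeries ℤ) ▸ hne one_pos
  refine mul_left_cancel₀ (mul_ne_zero (mul_ne_zero (mul_ne_zero
    (hne (Nat.mul_pos hp (by omega : 0 < q))) (hne (Nat.mul_pos (by omega : 0 < q) hr)))
    (hne (Nat.mul_pos hr hp))) hX) (h2.trans ?_)
  rw [mul_comm r p]
  generalize PowerSeries.mk (fun n ↦ if n % (p * q) < p then (1 : ℤ) else 0) = E at *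
  linear_combination (-(PowerSeries.X ^ p - 1) * (PowerSeries.X ^ q - 1)) * h1 +
    ((PowerSeries.X ^ (p * r) - 1) * (PowerSeries.X ^ (q * r) - 1) *
      (expand ℤ r F : PowerSeries ℤ) * (1 - PowerSeries.X ^ q)) * h4

/-- Arithmetic hypotheses under which the coefficients of `Q_{p,q,r}` near degree `r * N` are sums
of binary coefficients along an arithmetic progression of difference `w`. -/
theorem coeff_Qpoly_eq_sum {p q r w v N K : ℕ} (hp : 0 < p) (hq : 1 < q) (hr : p < r)
    (hpq : p.Coprime q) (hqr : q.Coprime r) (hrp : r.Coprime p) {F : ℤ[X]}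
    (hF : (X ^ p - 1) * (X ^ q - 1) * F = (X ^ (p * q) - 1) * (X - 1))
    (hrw : r * w ≡ 1 [MOD p * q]) (hw0 : 0 < w) (hwv : w ≡ v [MOD p]) (hpw : p * w < q)
    (hvp : v < p) (hK : K ≤ p) (hN : N + p * w < q * v) (hKN : K * w ≤ N) :
    (Qpoly p q r).coeff (r * N + (p - K)) = ∑ s ∈ Finset.range K, F.coeff (N - s * w) := by
  have hqvp : q * v + q ≤ p * q := by nlinarith
  have hrpos : 0 < r := by omega
  have hinv : ∀ j m M : ℤ, (p * q : ℤ) ∣ r * j + M - m → (p * q : ℤ) ∣ j + (M - m) * w := by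
    intro j m M h
    have h1 : (p * q : ℤ) ∣ r * w - 1 := by
      have := (Nat.modEq_iff_dvd.1 hrw.symm); push_cast at this; exact this
    have : j + (M - m) * w = (r * j + M - m) * w - j * (r * w - 1) := by ring
    rw [this]
    exact dvd_sub (h.mul_right _) (h1.mul_left _)
  have hmod : ∀ x : ℕ, (p * q : ℤ) ∣ x - ((x % (p * q) : ℕ) : ℤ) := by
    intro x
    have := Nat.modEq_iff_dvd.1 (Nat.mod_modEq x (p * q))
    push_cast at this ⊢; exact this
  rw [← Polynomial.coeff_coe, Qpoly_coe_eq hp hq hrpos hpq hqr hrp hF, mul_sub, mul_one, map_sub,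
    PowerSeries.coeff_mul_X_pow']
  have hsecond : (if q ≤ r * N + (p - K) then (PowerSeries.coeff (r * N + (p - K) - q))
      ((expand ℤ r F : PowerSeries ℤ) *
        PowerSeries.mk fun n ↦ if n % (p * q) < p then (1 : ℤ) else 0) else 0) = 0 := by
    split_ifs with hle
    swap
    · rfl
    rw [PowerSeries.coeff_mul]
    refine Finset.sum_eq_zero fun x hx ↦ ?_
    rw [Finset.HasAntidiagonal.mem_antidiagonal] at hx
    rw [Polynomial.coeff_coe, coeff_expand hrpos, PowerSeries.coeff_mk]
    split_ifs with hd hlt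
    · exfalso
      obtain ⟨i, hi⟩ := hd
      have h1 := hmod x.2
      have h2 : (x.2 : ℤ) = r * ((N : ℤ) - i) + (p - K : ℕ) - q := by
        rw [hi] at hx
        zify [hle] at hx ⊢
        linarith
      have hiN : i ≤ N := by
        by_contra hlt'
        have : r * (N + 1) ≤ r * i := Nat.mul_le_mul_left r (by omega)
        rw [hi] at hx
        have h5 : r * (N + 1) = r * N + r := by ring
        omega
      set m := x.2 % (p * q)
      have h3 := hinv (N - i) m ((p - K : ℕ) - q) (by rw [h2] at h1; convert h1 using 1; ring)
      have h4 : (p * q : ℤ) ∣ q * w - q * v := by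
        have h5 := mul_dvd_mul_left (q : ℤ) (Nat.modEq_iff_dvd.1 hwv.symm)
        rwa [mul_comm (p : ℤ), ← mul_sub]
      have h5 := dvd_add h3 h4
      have h6 : (N : ℤ) - i + ((p - K : ℕ) - q - m) * w + (q * w - q * v) =
          (N - i) + ((p - K : ℕ) - m) * w - q * v := by ring
      rw [h6] at h5
      have h7 : (0:ℤ) ≤ (p - K : ℕ) := by positivity
      have h8 : ((p - K : ℕ) : ℤ) ≤ p := by omega
      have h9 : (m : ℤ) < p := by exact_mod_cast hlt
      have h10 : (0 : ℤ) ≤ m := by positivity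
      have hw0' : (0 : ℤ) < w := by exact_mod_cast hw0
      have hup : (N - i : ℤ) + ((p - K : ℕ) - m) * w - q * v < 0 := by
        have : (((p - K : ℕ) : ℤ) - m) * w ≤ p * w := by
          apply mul_le_mul_of_nonneg_right _ hw0'.le; omega
        zify at hN; omega
      have hlow : -(p * q : ℤ) < (N - i : ℤ) + ((p - K : ℕ) - m) * w - q * v := by
        have : -(p * w : ℤ) ≤ (((p - K : ℕ) : ℤ) - m) * w := by
          rw [← neg_mul]
          apply mul_le_mul_of_nonneg_right _ hw0'.le; omega
        zify at hqvp hpw hiN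
        linarith
      have := Int.eq_zero_of_abs_lt_dvd h5 (by rw [abs_lt]; constructor <;> linarith)
      omega
    all_goals simp
  rw [hsecond, sub_zero, PowerSeries.coeff_mul]
  symm
  refine Finset.sum_of_injOn (fun s ↦ (r * (N - s * w), r * (s * w) + (p - K))) ?_ ?_ ?_ ?_
  · intro s hs t ht h
    have h1 : r * (s * w) + (p - K) = r * (t * w) + (p - K) := congrArg Prod.snd h
    have h2 := Nat.eq_of_mul_eq_mul_left hrpos (Nat.add_right_cancel h1)
    exact Nat.eq_of_mul_eq_mul_right hw0 h2
  · intro s hs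
    have hs' : s < K := by simpa using hs
    have : s * w ≤ N := (Nat.mul_le_mul_right w hs'.le).trans hKN
    refine Finset.mem_coe.2 (Finset.HasAntidiagonal.mem_antidiagonal.2 ?_)
    dsimp only
    rw [← add_assoc, ← mul_add, Nat.sub_add_cancel this]
  · intro x hx hnot
    rw [Finset.HasAntidiagonal.mem_antidiagonal] at hx
    rw [Polynomial.coeff_coe, coeff_expand hrpos, PowerSeries.coeff_mk]
    split_ifs with hd hlt
    · exfalso
      obtain ⟨i, hi⟩ := hd
      have hiN : i ≤ N := by
        by_contra hlt'
        have : r * (N + 1) ≤ r * i := Nat.mul_le_mul_left r (by omega)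
        rw [hi] at hx
        have h5 : r * (N + 1) = r * N + r := by ring
        omega
      have h1 := hmod x.2
      have h2 : (x.2 : ℤ) = r * ((N : ℤ) - i) + (p - K : ℕ) := by
        rw [hi] at hx
        zify at hx ⊢
        linarith
      set m := x.2 % (p * q)
      have h3 := hinv (N - i) m (p - K : ℕ) (by rw [h2] at h1; exact h1)
      have hw0' : (0 : ℤ) < w := by exact_mod_cast hw0
      have hNpq : (N : ℤ) + p * w < p * q := by
        zify at hN hqvp; linarith
      rcases lt_or_ge m (p - K) with hm | hm
      · have hpos : 0 < (N - i : ℤ) + ((p - K : ℕ) - m) * w := by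
          have : 0 < (((p - K : ℕ) : ℤ) - m) * w := mul_pos (by omega) hw0'
          omega
        have : (((p - K : ℕ) : ℤ) - m) * w ≤ p * w := by
          apply mul_le_mul_of_nonneg_right _ hw0'.le; omega
        have := Int.le_of_dvd hpos h3
        omega
      · obtain ⟨s, hs⟩ := Nat.exists_eq_add_of_le hm
        have hsK : s < K := by omega
        have hm' : (((p - K : ℕ) : ℤ) - m) * w = -(s * w) := by rw [hs]; push_cast; ring
        rw [hm'] at h3
        have hsw : (s * w : ℤ) ≤ p * w := by
          apply mul_le_mul_of_nonneg_right _ hw0'.le; omega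
        have hsw0 : (0 : ℤ) ≤ s * w := by positivity
        have h0 := Int.eq_zero_of_abs_lt_dvd h3
          (by rw [abs_lt]; constructor <;> omega)
        have hisw : N = i + s * w := by zify; omega
        refine hnot ⟨s, by simpa using hsK, ?_⟩
        ext
        · simp [hi, hisw]
        · zify
          rw [h2, hisw]; push_cast; ring
    all_goals simp
  · intro s hs
    have hs' : s < K := by simpa using hs
    have hmodlt : (r * (s * w) + (p - K)) % (p * q) < p := by
      have h1 : r * (s * w) + (p - K) ≡ s + (p - K) [MOD p * q] := by
        have := (hrw.mul_left s).add_right (p - K)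
        rw [mul_one] at this
        convert this using 1; ring
      refine lt_of_le_of_lt (h1.symm ▸ Nat.mod_le _ _ : _ ≤ s + (p - K)) (by omega)
    rw [Polynomial.coeff_coe, coeff_expand hrpos, PowerSeries.coeff_mk, if_pos (dvd_mul_right _ _),
      if_pos hmodlt, Nat.mul_div_cancel_left _ hrpos, mul_one]

theorem semigroupIndicator_of_dvd {p q l i y : ℕ} (hy : y < p) (h : (p : ℤ) ∣ y - i * l) :
    semigroupIndicator p q l i = if y * q ≤ i then 1 else 0 := by
  have h1 : i * l % p = y := by
    have : i * l ≡ y [MOD p] := Nat.modEq_iff_dvd.2 (by push_cast; exact h)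
    simpa [Nat.ModEq, Nat.mod_eq_of_lt hy] using this
  rw [semigroupIndicator, h1]

theorem mem_coeffSet_of_abs_le_s2 {p q r w v l : ℕ} (hl3 : 3 ≤ l) (hlp : 2 * l ≤ p)
    (hvl : v + l = p + 2) (hpq : p.Coprime q) (hqr : q.Coprime r) (hrp : r.Coprime p)
    (hlq : l * q ≡ 1 [MOD p]) (hqv : q ≡ v [MOD p]) (hwv : w ≡ v [MOD p]) (hw0 : 0 < w)
    (hpw : p * w + 1 < q) (hrw : r * w ≡ 1 [MOD p * q]) (hr : p < r) {n : ℤ} (hn : |n| ≤ l) :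
    n ∈ coeffSet p q r := by
  have hp : 0 < p := by omega
  have hq : 1 < q := by omega
  obtain ⟨F, hF, hFc⟩ := exists_binary_polynomial hp (by omega) hpq hlq
  have hwq : p * w < q := by omega
  have coeff_eq := fun {N K : ℕ} (hK : K ≤ p) (hN : N + p * w < q * v) (hKN : K * w ≤ N) ↦
    coeff_Qpoly_eq_sum hp hq hr hpq hqr hrp hF hrw hw0 hwv hwq (by omega) hK hN hKN
  have hql : (p : ℤ) ∣ 1 - l * q := by
    have := Nat.modEq_iff_dvd.1 hlq; push_cast at this; exact this
  have hwl : (p : ℤ) ∣ l * w - 1 := by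
    have := Nat.modEq_iff_dvd.1 (((hwv.trans hqv.symm).mul_left l).trans hlq).symm
    push_cast at this; exact this
  have hcomb : ∀ c s : ℤ, (p : ℤ) ∣ c * (1 - l * q) + s * (l * w - 1) := fun c s ↦
    dvd_add (hql.mul_left c) (hwl.mul_left s)
  have hsw : ∀ {s : ℕ}, s < p → s * w + 1 < q := fun {s} hs ↦ by
    have := Nat.mul_le_mul_right w hs.le; omega
  have hsq : ∀ {s : ℕ}, s * w ≤ s * q := fun {s} ↦
    Nat.mul_le_mul_left s (by have := Nat.le_mul_of_pos_left w hp; omega)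
  have hmem := fun {m : ℕ} (h : (Qpoly p q r).coeff m ≠ 0) ↦
    mem_coeffSet_of_ne_zero hp (by omega) (by omega) hpq hqr hrp h
  rw [abs_le] at hn
  rcases lt_trichotomy n 0 with h | rfl | h
  · obtain ⟨K, rfl⟩ : ∃ K : ℕ, n = -K := ⟨n.natAbs, by omega⟩
    obtain ⟨c, hc⟩ : ∃ c, p = l + 1 + c := Nat.exists_eq_add_of_le (by omega)
    have hcpos : q ≤ c * q := Nat.le_mul_of_pos_left q (by omega)
    have hv : (c + 1) * q ≤ q * v := by rw [mul_comm q]; exact Nat.mul_le_mul_right q (by omega)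
    rw [add_mul, one_mul] at hv
    have hKw := hsw (s := K) (by omega)
    have key := coeff_eq (N := c * q + 1) (K := K) (by omega) (by omega) (by omega)
    rw [Finset.sum_congr rfl (g := fun _ ↦ (-1 : ℤ))] at key
    · have key' : (Qpoly p q r).coeff (r * (c * q + 1) + (p - K)) = -K := by simp [key]
      rw [← key']
      exact hmem (by rw [key']; omega)
    · intro s hs
      have hsK : s < K := Finset.mem_range.1 hs
      have hsl : s < l := by omega
      have hs1 := hsw (s := s) (by omega)
      obtain ⟨y, hy⟩ : ∃ y, c = s + y := Nat.exists_eq_add_of_le (by omega)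
      obtain ⟨t, ht⟩ : ∃ t, c * q = s * w + t := Nat.exists_eq_add_of_le (by omega)
      rw [show c * q + 1 - s * w = t + 1 by omega, hFc,
        semigroupIndicator_of_dvd (y := y + l) (by omega), semigroupIndicator_of_dvd (y := y) (by omega),
        if_neg, if_pos]
      · rfl
      · have : c * q = s * q + y * q := by rw [hy, add_mul]
        have := hsq (s := s)
        omega
      · have : (c + 1) * q ≤ (y + l) * q := Nat.mul_le_mul_right q (by omega)
        rw [add_mul, one_mul] at this
        omega
      · convert hcomb c s using 1
        zify at ht hy
        linear_combination -hy + l * ht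
      · convert hcomb c s using 1
        zify at ht hy
        push_cast
        linear_combination -hy + l * ht
  · have key := coeff_eq (N := 0) (K := 0) (by omega)
      (by have : q * 1 ≤ q * v := Nat.mul_le_mul_left q (by omega)
          omega) (by simp)
    refine ⟨p, ?_, by simpa using key⟩
    obtain ⟨a, rfl⟩ := Nat.exists_eq_add_of_le' (show 2 ≤ p by omega)
    have h1 : 2 ≤ q - 1 := by
      have := Nat.le_mul_of_pos_right (a + 2) hw0
      omega
    have h2 : 1 ≤ r - 1 := by omega
    calc a + 2 ≤ (a + 2 - 1) * 2 * 1 := by omega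
      _ ≤ _ := Nat.mul_le_mul (Nat.mul_le_mul le_rfl h1) h2
  · obtain ⟨K, rfl⟩ : ∃ K : ℕ, n = K := ⟨n.natAbs, by omega⟩
    obtain ⟨c, hc⟩ : ∃ c, l = 1 + c := Nat.exists_eq_add_of_le (by omega)
    have hcpos : q ≤ c * q := Nat.le_mul_of_pos_left q (by omega)
    have hv : (c + 1) * q ≤ q * v := by rw [mul_comm q]; exact Nat.mul_le_mul_right q (by omega)
    rw [add_mul, one_mul] at hv
    have hKw := hsw (s := K) (by omega)
    have key := coeff_eq (N := c * q) (K := K) (by omega) (by omega) (by omega)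
    rw [Finset.sum_congr rfl (g := fun _ ↦ (1 : ℤ))] at key
    · have key' : (Qpoly p q r).coeff (r * (c * q) + (p - K)) = K := by simp [key]
      rw [← key']
      exact hmem (by rw [key']; omega)
    · intro s hs
      have hsK : s < K := Finset.mem_range.1 hs
      have hs1 := hsw (s := s) (by omega)
      obtain ⟨y, hy⟩ : ∃ y, c = s + y := Nat.exists_eq_add_of_le (by omega)
      obtain ⟨z, hz⟩ : ∃ z, p = 1 + s + z := Nat.exists_eq_add_of_le (by omega)
      obtain ⟨t, ht⟩ : ∃ t, c * q = s * w + 1 + t := Nat.exists_eq_add_of_le (by omega)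
      rw [show c * q - s * w = t + 1 by omega, hFc,
        semigroupIndicator_of_dvd (y := y) (by omega), semigroupIndicator_of_dvd (y := z) (by omega),
        if_pos, if_neg]
      · rfl
      · have : (c + 1) * q ≤ z * q := Nat.mul_le_mul_right q (by omega)
        rw [add_mul, one_mul] at this
        omega
      · have : c * q = s * q + y * q := by rw [hy, add_mul]
        have := hsq (s := s)
        omega
      · have : (z : ℤ) - t * l = c * (1 - l * q) + s * (l * w - 1) + p := by
          zify at ht hz hc
          linear_combination -hz + l * ht + hc
        rw [this]
        exact dvd_add (hcomb c s) dvd_rfl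
      · convert hcomb c s using 1
        zify at ht hy
        push_cast
        linear_combination -hy + l * ht

/-- Solvability of the congruences required of the last two prime powers. -/
theorem exists_prime_powers {p q r : ℕ} (hp : p.Prime) (hq : q.Prime) (hr : r.Prime)
    (hpq : p ≠ q) (hpr : p ≠ r) (hqr : q ≠ r) :
    ∃ k, ∀ a v : ℕ, 0 < a → k ≤ a → v ≡ 1 [MOD p ^ k] → ∃ b c w : ℕ, 0 < b ∧ 0 < c ∧
      q ^ b ≡ v [MOD p ^ a] ∧ w ≡ v [MOD p ^ a] ∧ p ^ a * w + 1 < q ^ b ∧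
      r ^ c * w ≡ 1 [MOD p ^ a * q ^ b] ∧ p ^ a < r ^ c := by
  have hcpq := (Nat.coprime_primes hp hq).2 hpq
  have hcrp := (Nat.coprime_primes hr hp).2 hpr.symm
  have hcrq := (Nat.coprime_primes hr hq).2 hqr.symm
  obtain ⟨k₁, h₁⟩ := exists_pow_mul_modEq hp hq.one_lt hcpq.symm one_pos
  obtain ⟨k₂, l, h₂⟩ := exists_pow_modEq_prime_pow_mul hp hq hr.one_lt hpq hcrp hcrq
  refine ⟨k₁ + k₂, fun a v ha hka hv ↦ ?_⟩
  have hP := pow_pos hp.pos a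
  obtain ⟨b₀, hb₀⟩ := h₁ 1 (Nat.coprime_one_left p) a v
    (hv.of_dvd (pow_dvd_pow p (Nat.le_add_right _ _)))
  simp only [one_mul] at hb₀
  have hcop : (p ^ a).Coprime (q ^ l) := Nat.Coprime.pow a l hcpq
  obtain ⟨⟨w, hwv, hwl⟩, hwlt⟩ : ∃ x : {w // w ≡ v [MOD p ^ a] ∧ w ≡ 1 [MOD q ^ l]},
      (x : ℕ) < p ^ a * q ^ l :=
    ⟨Nat.chineseRemainder hcop v 1,
      Nat.chineseRemainder_lt_mul hcop v 1 hP.ne' (pow_pos hq.pos l).ne'⟩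
  have htP : 0 < Nat.totient (p ^ a) := Nat.totient_pos.2 hP
  set b := b₀ + Nat.totient (p ^ a) * (p ^ a * w + 2)
  have hb : q ^ b ≡ v [MOD p ^ a] := by
    have := hb₀.mul ((Nat.ModEq.pow_totient (hcpq.symm.pow_right a)).pow (p ^ a * w + 2))
    rwa [one_pow, mul_one, ← pow_mul, ← pow_add] at this
  have hble : p ^ a * w + 2 ≤ b := (Nat.le_mul_of_pos_left _ htP).trans (Nat.le_add_left _ _)
  have hbpos : 0 < b := by omega
  have hqb : b < q ^ b := Nat.lt_pow_self hq.one_lt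
  obtain ⟨c₀, hc₀⟩ := h₂ a b w ha hbpos
    ((hwv.of_dvd (pow_dvd_pow p (by omega))).trans (hv.of_dvd (pow_dvd_pow p (Nat.le_add_left _ _))))
    hwl
  set T := Nat.totient (p ^ a * q ^ b)
  have hT : 0 < T := Nat.totient_pos.2 (Nat.mul_pos hP (pow_pos hq.pos b))
  have hone : r ^ T ≡ 1 [MOD p ^ a * q ^ b] :=
    Nat.ModEq.pow_totient ((hcrp.pow_right a).mul_right (hcrq.pow_right b))
  set c := c₀ * (T - 1) + T * p ^ a
  have hcle : p ^ a ≤ c := (Nat.le_mul_of_pos_left _ hT).trans (Nat.le_add_left _ _)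
  refine ⟨b, c, w, hbpos, by omega, hb, hwv, by omega, ?_,
    hcle.trans_lt (Nat.lt_pow_self hr.one_lt)⟩
  have h3 : r ^ c * r ^ c₀ ≡ 1 [MOD p ^ a * q ^ b] := by
    have : r ^ c * r ^ c₀ = (r ^ T) ^ (c₀ + p ^ a) := by
      rw [← pow_add, ← pow_mul]
      congr 1
      obtain ⟨T', hT'⟩ := Nat.exists_eq_add_of_le' hT
      simp only [c, hT', Nat.add_sub_cancel]
      ring
    rw [this]
    simpa using hone.pow (c₀ + p ^ a)
  exact (hc₀.symm.mul_left _).trans h3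

theorem exists_abs_le_subset_coeffSet {p q r : ℕ} (hp : p.Prime) (hq : q.Prime) (hr : r.Prime)
    (hpq : p ≠ q) (hpr : p ≠ r) (hqr : q ≠ r) {ε : ℝ} (hε : 0 < ε) :
    ∃ A : ℕ, ∀ a : ℕ, A ≤ a → ∃ b c : ℕ, 0 < b ∧ 0 < c ∧ 2 < p ^ a ∧ 2 < q ^ b ∧ 2 < r ^ c ∧
      ∃ l : ℕ, 3 ≤ l ∧ (1 / 2 - ε) * (p : ℝ) ^ a ≤ l ∧
        ∀ n : ℤ, |n| ≤ l → n ∈ coeffSet (p ^ a) (q ^ b) (r ^ c) := by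
  obtain ⟨k, hk⟩ := exists_prime_powers hp hq hr hpq hpr hqr
  obtain ⟨M, hM⟩ := exists_nat_gt (2 / ε)
  refine ⟨2 * k + 2 * M + 6, fun a ha ↦ ?_⟩
  obtain ⟨j, i, haj, hij, hji, hMi, hkj⟩ :
      ∃ j i, a = j + i ∧ i ≤ j ∧ j ≤ i + 1 ∧ M + 3 ≤ i ∧ k ≤ j :=
    ⟨(a + 1) / 2, a / 2, by omega, by omega, by omega, by omega, by omega⟩
  have hj2 : 2 ≤ p ^ j := hp.two_le.trans (Nat.le_self_pow (by omega) p)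
  have hi8 : 8 ≤ p ^ i := (Nat.pow_le_pow_left hp.two_le 3).trans
    (Nat.pow_le_pow_right hp.pos (by omega))
  have hpa : p ^ a = p ^ j * p ^ i := by rw [haj, pow_add]
  have h8 : p ^ j * 8 ≤ p ^ a := hpa ▸ Nat.mul_le_mul_left _ hi8
  set t := (p ^ a / 2 - 1) / p ^ j
  have ht1 : p ^ j * t ≤ p ^ a / 2 - 1 := Nat.mul_div_le _ _
  have ht2 : p ^ a / 2 - 1 < p ^ j * t + p ^ j := Nat.lt_mul_div_succ _ (by omega)
  set l := 1 + p ^ j * t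
  set v := p ^ a + 1 - p ^ j * t
  have hvl : v + l = p ^ a + 2 := by omega
  have hv1 : v ≡ 1 [MOD p ^ k] := by
    refine Nat.modEq_iff_dvd.2 ?_
    have : (1 : ℤ) - v = p ^ j * t - p ^ a := by zify at hvl; simp only [l] at hvl; push_cast at hvl; linarith
    push_cast
    rw [this]
    exact dvd_sub ((pow_dvd_pow _ hkj).mul_right _) (pow_dvd_pow _ (by omega))
  have hlv : l * v ≡ 1 [MOD p ^ a] := by
    refine Nat.modEq_iff_dvd.2 ?_
    have h1 : (v : ℤ) = p ^ a + 1 - p ^ j * t := by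
      zify at hvl; simp only [l] at hvl; push_cast at hvl; linarith
    obtain ⟨e, rfl⟩ := Nat.exists_eq_add_of_le hij
    refine ⟨p ^ e * t ^ 2 - l, ?_⟩
    rw [haj] at h1 ⊢
    push_cast
    rw [h1]
    simp only [l]
    push_cast
    ring
  obtain ⟨b, c, w, hb, hc, hbv, hwv, hwb, hrw, hpr'⟩ := hk a v (by omega) (by omega) hv1
  have hlq := (hbv.mul_left l).trans hlv
  have hw0 : 0 < w := by
    rcases Nat.eq_zero_or_pos w with rfl | h
    · have := Nat.le_of_dvd one_pos ((Nat.modEq_zero_iff_dvd.1 hrw.symm))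
      have := Nat.le_mul_of_pos_right (p ^ a) (pow_pos hq.pos b)
      omega
    · exact h
  have hww := Nat.le_mul_of_pos_right (p ^ a) hw0
  refine ⟨b, c, hb, hc, by omega, by omega, by omega, l, by omega, ?_, fun n hn ↦ ?_⟩
  · have h1 : (p ^ a : ℝ) ≤ 2 * (l + p ^ j) := by
      have : p ^ a ≤ 2 * (l + p ^ j) := by omega
      exact_mod_cast this
    have h2 : (2 : ℝ) ≤ ε * p ^ i := by
      have h3 : (M : ℝ) ≤ p ^ i := by
        have := (Nat.lt_pow_self hp.one_lt : i < p ^ i)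
        exact_mod_cast (by omega : M ≤ p ^ i)
      rw [div_lt_iff₀ hε] at hM
      nlinarith
    have h3 : (p ^ a : ℝ) = p ^ j * p ^ i := by exact_mod_cast hpa
    have h4 : (0 : ℝ) < p ^ j := by have := hp.pos; positivity
    have h5 : (2 : ℝ) * p ^ j ≤ ε * p ^ a := by rw [h3]; nlinarith
    linarith
  · exact mem_coeffSet_of_abs_le_s2 (by omega) (by omega) hvl
      (Nat.Coprime.pow a b ((Nat.coprime_primes hp hq).2 hpq))
      (Nat.Coprime.pow b c ((Nat.coprime_primes hq hr).2 hqr))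
      (Nat.Coprime.pow c a ((Nat.coprime_primes hr hp).2 hpr.symm))
      hlq hbv hwv hw0 hwb hrw hpr' hn

theorem stmt_2 (p q r : ℕ) (hp : p.Prime) (hq : q.Prime) (hr : r.Prime)
    (hpq : p ≠ q) (hpr : p ≠ r) (hqr : q ≠ r) :
    ∀ ε : ℝ, 0 < ε → ∃ aε : ℕ, ∀ a : ℕ, aε ≤ a →
      (∃ b c : ℕ, 0 < b ∧ 0 < c ∧ 2 < p ^ a ∧ 2 < q ^ b ∧ 2 < r ^ c ∧
        ∀ n : ℤ, -1 ≤ n → (n : ℝ) ≤ (1 / 2 - ε) * (p : ℝ) ^ a →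
          n ∈ coeffSet (p ^ a) (q ^ b) (r ^ c)) ∧
      (∃ b' c' : ℕ, 0 < b' ∧ 0 < c' ∧ 2 < p ^ a ∧ 2 < q ^ b' ∧ 2 < r ^ c' ∧
        ∀ n : ℤ, -((1 / 2 - ε) * (p : ℝ) ^ a) ≤ (n : ℝ) → n ≤ 1 →
          n ∈ coeffSet (p ^ a) (q ^ b') (r ^ c')) := by
  intro ε hε
  obtain ⟨A, hA⟩ := exists_abs_le_subset_coeffSet hp hq hr hpq hpr hqr hε
  refine ⟨A, fun a ha ↦ ?_⟩
  obtain ⟨b, c, hb, hc, h2p, h2q, h2r, l, hl3, hl, hmem⟩ := hA a ha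
  refine ⟨⟨b, c, hb, hc, h2p, h2q, h2r, fun n hn hn' ↦ hmem n ?_⟩,
    ⟨b, c, hb, hc, h2p, h2q, h2r, fun n hn hn' ↦ hmem n ?_⟩⟩
  · have : n ≤ l := by exact_mod_cast hn'.trans hl
    rw [abs_le]
    omega
  · have : -(l : ℤ) ≤ n := by exact_mod_cast (neg_le_neg hl).trans hn
    rw [abs_le]
    omega
end
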